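/- arXiv:1911.12844 — 8 statements merged into one kernel-verified Lean document; each statement's English description precedes it below -/
import Mathlib

section
/- Let g be a finite-dimensional complex semisimple Lie algebra and (h, e, f) an sl2-triple in g. Let j ≥ 2 and m ≥ j be integers, c ∈ ℂ, and let x = c·e + x_j + x_{j+1} + ⋯ + x_m, where for each k the element x_k lies in the eigenspace g_{2k} of ad h with eigenvalue 2k. The eigenspace g_{2j−2} decomposes as the internal direct sum g_{2j−2} = (ker(ad e) ∩ g_{2j−2}) ⊕ [f, g_{2j}], where [f, g_{2j}] = {[f, y] : y ∈ g_{2j}}. If the component of exp(ad x)(f) lying in the summand [f, g_{2j}] of this decomposition is zero, then x_j = 0. -/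
/-- The exponential of `ad x`, given by the (truncated) exponential series; when `ad x` is
nilpotent this finite sum agrees with `exp (ad x) = Σ_{i ≥ 0} (1/i!)·(ad x)^i`, since a
nilpotent endomorphism of an `n`-dimensional space satisfies `(ad x)^n = 0`. -/
noncomputable def expAd {L : Type*} [LieRing L] [LieAlgebra ℂ L] [FiniteDimensional ℂ L]
    (x : L) : Module.End ℂ L :=
  ∑ i ∈ Finset.range (Module.finrank ℂ L + 1),
    ((Nat.factorial i : ℂ))⁻¹ • (LieAlgebra.ad ℂ L x) ^ i

section Sl2Representation

variable {L M : Type*} [LieRing L] [LieAlgebra ℂ L] [AddCommGroup M] [Module ℂ M]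
  [LieRingModule L M] [LieModule ℂ L M] {h e f : L}

lemma IsSl2Triple.exists_pow_toEnd_e_eq_zero [FiniteDimensional ℂ M] (t : IsSl2Triple h e f)
    {y : M} {μ : ℂ} (hy : ⁅h, y⁆ = μ • y) : ∃ n : ℕ, (LieModule.toEnd ℂ L M e ^ n) y = 0 := by
  by_contra! hne
  have hinj : Function.Injective fun n : ℕ ↦ μ + 2 * (n : ℂ) := fun a b hab ↦ by
    simpa using hab
  have hli := Module.End.eigenvectors_linearIndependent' (LieModule.toEnd ℂ L M h)
    (fun n : ℕ ↦ μ + 2 * (n : ℂ)) hinj (fun n ↦ (LieModule.toEnd ℂ L M e ^ n) y)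
    fun n ↦ ⟨by
      rw [Module.End.mem_eigenspace_iff, LieModule.toEnd_apply_apply]
      exact t.lie_h_pow_toEnd_e hy n, hne n⟩
  have := hli.finite
  exact not_finite ℕ

lemma IsSl2Triple.lie_f_pow_succ_toEnd_e (t : IsSl2Triple h e f) {y : M} {μ : ℂ}
    (hy : ⁅h, y⁆ = μ • y) (hef : ⁅e, ⁅f, y⁆⁆ = 0) (n : ℕ) :
    ⁅f, (LieModule.toEnd ℂ L M e ^ (n + 1)) y⁆ =
      (-((n + 1) * (μ + n)) : ℂ) • (LieModule.toEnd ℂ L M e ^ n) y := by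
  have lie_f_lie_e (z : M) : ⁅f, ⁅e, z⁆⁆ = ⁅e, ⁅f, z⁆⁆ - ⁅h, z⁆ := by
    rw [← t.lie_e_f, lie_lie, sub_sub_cancel]
  induction n with
  | zero => simp [lie_f_lie_e, hef, hy]
  | succ n ih =>
    rw [pow_succ', Module.End.mul_apply, LieModule.toEnd_apply_apply, lie_f_lie_e, ih, lie_smul,
      t.lie_h_pow_toEnd_e hy, IsSl2Triple.lie_e_pow_toEnd_e, ← sub_smul]
    congr 1
    push_cast
    ring

/-- In a finite-dimensional representation of `sl₂`, the operator `e f` is injective on weight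
spaces of positive weight. -/
lemma IsSl2Triple.eq_zero_of_lie_e_lie_f_eq_zero [FiniteDimensional ℂ M] (t : IsSl2Triple h e f)
    {y : M} {k : ℤ} (hk : 0 < k) (hy : ⁅h, y⁆ = (k : ℂ) • y) (hef : ⁅e, ⁅f, y⁆⁆ = 0) :
    y = 0 := by
  obtain ⟨n, hn⟩ := t.exists_pow_toEnd_e_eq_zero hy
  induction n with
  | zero => simpa using hn
  | succ n ih =>
    have hcoeff : (-((n + 1) * (k + n)) : ℂ) ≠ 0 := by
      have : (-((n + 1) * (k + n)) : ℤ) ≠ 0 := neg_ne_zero.mpr (by positivity)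
      exact_mod_cast this
    have hsmul := t.lie_f_pow_succ_toEnd_e hy hef n
    rw [hn, lie_zero, eq_comm] at hsmul
    exact ih ((smul_eq_zero.mp hsmul).resolve_left hcoeff)

end Sl2Representation

section Grading

variable {L : Type*} [LieRing L] [LieAlgebra ℂ L]

/-- The eigenspace of `ad h` for the integer eigenvalue `k`. -/
abbrev adWeightSpace (h : L) (k : ℤ) : Submodule ℂ L :=
  Module.End.eigenspace (LieAlgebra.ad ℂ L h) (k : ℂ)

/-- The sum of the eigenspaces of `ad h` for the integer eigenvalues at least `n`. -/
def adWeightFiltration (h : L) (n : ℤ) : Submodule ℂ L :=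
  ⨆ (k : ℤ) (_ : n ≤ k), adWeightSpace h k

variable {h : L}

lemma mem_adWeightSpace {k : ℤ} {y : L} : y ∈ adWeightSpace h k ↔ ⁅h, y⁆ = (k : ℂ) • y := by
  rw [Module.End.mem_eigenspace_iff, LieAlgebra.ad_apply]

lemma lie_mem_adWeightSpace {a b : ℤ} {y z : L} (hy : y ∈ adWeightSpace h a)
    (hz : z ∈ adWeightSpace h b) : ⁅y, z⁆ ∈ adWeightSpace h (a + b) := by
  rw [mem_adWeightSpace] at *
  rw [leibniz_lie, hy, hz, smul_lie, lie_smul, ← add_smul, Int.cast_add]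

lemma adWeightSpace_le_filtration {n k : ℤ} (hk : n ≤ k) :
    adWeightSpace h k ≤ adWeightFiltration h n :=
  le_iSup₂_of_le k hk le_rfl

lemma adWeightFiltration_anti {a b : ℤ} (hab : a ≤ b) :
    adWeightFiltration h b ≤ adWeightFiltration h a :=
  iSup₂_le fun _ hk ↦ adWeightSpace_le_filtration (hab.trans hk)

lemma lie_mem_adWeightFiltration {a b : ℤ} {y z : L} (hy : y ∈ adWeightFiltration h a)
    (hz : z ∈ adWeightFiltration h b) : ⁅y, z⁆ ∈ adWeightFiltration h (a + b) := by
  have left {k : ℤ} (hk : a ≤ k) {y : L} (hy : y ∈ adWeightSpace h k) :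
      adWeightFiltration h b ≤ (adWeightFiltration h (a + b)).comap (LieAlgebra.ad ℂ L y) :=
    iSup₂_le fun l hl w hw ↦
      adWeightSpace_le_filtration (add_le_add hk hl) (lie_mem_adWeightSpace hy hw)
  have right : adWeightFiltration h a ≤
      (adWeightFiltration h (a + b)).comap (LieAlgebra.ad ℂ L z) := by
    refine iSup₂_le fun k hk w hw ↦ ?_
    rw [Submodule.mem_comap, LieAlgebra.ad_apply, ← lie_skew]
    exact neg_mem (left hk hw hz)
  rw [← lie_skew]
  exact neg_mem (right hy)

lemma mem_of_mem_sup_iSup_ne {A : Submodule ℂ L} {n : ℤ} (hA : A ≤ adWeightSpace h n) {v : L}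
    (hv : v ∈ adWeightSpace h n) (hvA : v ∈ A ⊔ ⨆ (k : ℤ) (_ : k ≠ n), adWeightSpace h k) :
    v ∈ A := by
  obtain ⟨a, ha, w, hw, rfl⟩ := Submodule.mem_sup.mp hvA
  have hind : iSupIndep fun k : ℤ ↦ adWeightSpace h k :=
    (Module.End.eigenspaces_iSupIndep (LieAlgebra.ad ℂ L h)).comp Int.cast_injective
  have hw0 : w = 0 :=
    Submodule.disjoint_def.mp (hind n) w ((Submodule.add_mem_iff_right _ (hA ha)).mp hv) hw
  simpa [hw0] using ha

end Grading

section Decomposition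

variable {L : Type*} [LieRing L] [LieAlgebra ℂ L] [FiniteDimensional ℂ L] {h e f : L}

lemma IsSl2Triple.ker_ad_e_sup_map_ad_f (t : IsSl2Triple h e f) {n : ℤ} (hn : 0 < n) :
    LinearMap.ker (LieAlgebra.ad ℂ L e) ⊓ adWeightSpace h (n - 2) ⊔
      (adWeightSpace h n).map (LieAlgebra.ad ℂ L f) = adWeightSpace h (n - 2) := by
  have he : e ∈ adWeightSpace h 2 := mem_adWeightSpace.mpr (by simpa using t.lie_h_e_smul ℂ)
  have hf : f ∈ adWeightSpace h (-2) :=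
    mem_adWeightSpace.mpr (by simpa using t.lie_lie_smul_f ℂ)
  have lie_f_mem {y : L} (hy : y ∈ adWeightSpace h n) : ⁅f, y⁆ ∈ adWeightSpace h (n - 2) := by
    simpa [neg_add_eq_sub] using lie_mem_adWeightSpace hf hy
  have lie_e_mem {u : L} (hu : u ∈ adWeightSpace h (n - 2)) : ⁅e, u⁆ ∈ adWeightSpace h n := by
    simpa using lie_mem_adWeightSpace he hu
  refine le_antisymm (sup_le inf_le_right ?_) fun u hu ↦ ?_
  · rintro _ ⟨y, hy, rfl⟩
    exact lie_f_mem hy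
  · let T : Module.End ℂ (adWeightSpace h n) :=
      (LieAlgebra.ad ℂ L e ∘ₗ LieAlgebra.ad ℂ L f).restrict fun y hy ↦ lie_e_mem (lie_f_mem hy)
    have hT : Function.Injective T := by
      rw [injective_iff_map_eq_zero]
      rintro ⟨y, hy⟩ hTy
      exact Subtype.ext (t.eq_zero_of_lie_e_lie_f_eq_zero hn (mem_adWeightSpace.mp hy)
        (congrArg Subtype.val hTy))
    obtain ⟨⟨y, hy⟩, hTy⟩ := LinearMap.surjective_of_injective hT ⟨⁅e, u⁆, lie_e_mem hu⟩
    replace hTy : ⁅e, ⁅f, y⁆⁆ = ⁅e, u⁆ := congrArg Subtype.val hTy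
    refine Submodule.mem_sup.mpr ⟨u - ⁅f, y⁆, ⟨?_, sub_mem hu (lie_f_mem hy)⟩, ⁅f, y⁆,
      ⟨y, hy, rfl⟩, sub_add_cancel _ _⟩
    simp [hTy]

lemma IsSl2Triple.ker_ad_e_inf_map_ad_f (t : IsSl2Triple h e f) {n : ℤ} (hn : 0 < n) :
    LinearMap.ker (LieAlgebra.ad ℂ L e) ⊓ adWeightSpace h (n - 2) ⊓
      (adWeightSpace h n).map (LieAlgebra.ad ℂ L f) = ⊥ := by
  rw [eq_bot_iff]
  rintro _ ⟨⟨hker, -⟩, y, hy, rfl⟩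
  have := t.eq_zero_of_lie_e_lie_f_eq_zero hn (mem_adWeightSpace.mp hy) hker
  simp [this]

end Decomposition

section Exponential

variable {L : Type*} [LieRing L] [LieAlgebra ℂ L] {h e f : L}

/-- For `x = c e + s` with `s` of weights at least `n ≥ 4`, the terms of degree at least two in the
exponential series of `ad x` at `f` only have the weight `2` and weights at least `n`. -/
lemma IsSl2Triple.ad_pow_add_two_apply_f_mem (t : IsSl2Triple h e f) (c : ℂ) {n : ℤ}
    (hn : 4 ≤ n) {s : L} (hs : s ∈ adWeightFiltration h n) (i : ℕ) :
    (LieAlgebra.ad ℂ L (c • e + s) ^ (i + 2)) f ∈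
      Submodule.span ℂ {e} ⊔ adWeightFiltration h n := by
  have he : e ∈ adWeightFiltration h 2 := adWeightSpace_le_filtration le_rfl
    (mem_adWeightSpace.mpr (by simpa using t.lie_h_e_smul ℂ))
  have hf : f ∈ adWeightFiltration h (-2) := adWeightSpace_le_filtration le_rfl
    (mem_adWeightSpace.mpr (by simpa using t.lie_lie_smul_f ℂ))
  have hh : h ∈ adWeightFiltration h 0 := adWeightSpace_le_filtration le_rfl
    (mem_adWeightSpace.mpr (by simp))
  have hx : c • e + s ∈ adWeightFiltration h 2 :=
    add_mem (Submodule.smul_mem _ c he) (adWeightFiltration_anti (by lia) hs)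
  have heh : ⁅e, h⁆ = (-2 : ℂ) • e := by
    rw [← lie_skew, t.lie_h_e_smul ℂ, neg_smul]
  induction i with
  | zero =>
    have hsh : ⁅s, h⁆ ∈ adWeightFiltration h n := by
      simpa using lie_mem_adWeightFiltration hs hh
    have hxsf : ⁅c • e + s, ⁅s, f⁆⁆ ∈ adWeightFiltration h n :=
      adWeightFiltration_anti (by lia)
        (lie_mem_adWeightFiltration hx (lie_mem_adWeightFiltration hs hf))
    have hexp : (LieAlgebra.ad ℂ L (c • e + s) ^ (0 + 2)) f =
        (c * c * -2) • e + (c • ⁅s, h⁆ + ⁅c • e + s, ⁅s, f⁆⁆) := by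
      rw [zero_add, pow_two, Module.End.mul_apply, LieAlgebra.ad_apply, LieAlgebra.ad_apply,
        add_lie _ _ f, lie_add, smul_lie _ _ f, t.lie_e_f, add_lie _ _ (c • h), smul_lie, lie_smul,
        lie_smul, heh, smul_smul, smul_smul, add_assoc]
    rw [hexp]
    exact Submodule.add_mem_sup (Submodule.smul_mem _ _ (Submodule.mem_span_singleton_self e))
      (add_mem (Submodule.smul_mem _ _ hsh) hxsf)
  | succ i ih =>
    obtain ⟨_, hu, g, hg, hug⟩ := Submodule.mem_sup.mp ih
    obtain ⟨d, rfl⟩ := Submodule.mem_span_singleton.mp hu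
    refine Submodule.mem_sup_right ?_
    rw [add_right_comm, pow_succ', Module.End.mul_apply, ← hug, LieAlgebra.ad_apply, lie_add,
      add_lie _ _ (d • e), smul_lie, lie_smul, lie_self, smul_zero, smul_zero, zero_add, lie_smul]
    exact add_mem
      (Submodule.smul_mem _ _ (adWeightFiltration_anti (by lia) (lie_mem_adWeightFiltration hs he)))
      (adWeightFiltration_anti (by lia) (lie_mem_adWeightFiltration hx hg))

lemma IsSl2Triple.expAd_apply_f_sub_lie_mem [FiniteDimensional ℂ L] (t : IsSl2Triple h e f)
    (c : ℂ) {n : ℤ} (hn : 4 ≤ n) {s : L} (hs : s ∈ adWeightFiltration h n) :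
    expAd (c • e + s) f - ⁅s, f⁆ ∈
      Submodule.span ℂ {e, h, f} ⊔ adWeightFiltration h n := by
  have : Nontrivial L := nontrivial_of_ne h 0 t.h_ne_zero
  obtain ⟨N, hN⟩ := Nat.exists_eq_add_of_lt (Module.finrank_pos (R := ℂ) (M := L))
  have hmem {y : L} (hy : y ∈ ({e, h, f} : Set L)) :
      y ∈ Submodule.span ℂ {e, h, f} ⊔ adWeightFiltration h n :=
    Submodule.mem_sup_left (Submodule.subset_span hy)
  have hexp : expAd (c • e + s) f - ⁅s, f⁆ =
      ∑ i ∈ Finset.range N, ((Nat.factorial (i + 2) : ℂ))⁻¹ •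
        (LieAlgebra.ad ℂ L (c • e + s) ^ (i + 2)) f + (c • h + f) := by
    rw [expAd, hN, zero_add, Finset.sum_range_succ', Finset.sum_range_succ']
    simp [t.lie_e_f]
    abel
  rw [hexp]
  refine add_mem (sum_mem fun i _ ↦ Submodule.smul_mem _ _ ?_)
    (add_mem (Submodule.smul_mem _ _ (hmem (by simp))) (hmem (by simp)))
  have hspan : Submodule.span ℂ {e} ≤ Submodule.span ℂ {e, h, f} :=
    Submodule.span_mono (Set.singleton_subset_iff.mpr (Set.mem_insert e {h, f}))
  exact sup_le_sup_right hspan (adWeightFiltration h n)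
    (t.ad_pow_add_two_apply_f_mem c hn hs i)

end Exponential

/-- Let `(h, e, f)` be an sl2-triple in a finite-dimensional complex
semisimple Lie algebra, `2 ≤ j ≤ m` integers, `c ∈ ℂ`, and
`x = c•e + x_j + ⋯ + x_m` with `x_k ∈ g_{2k}`.  The eigenspace `g_{2j−2}` decomposes as
`g_{2j−2} = (ker(ad e) ∩ g_{2j−2}) ⊕ [f, g_{2j}]`; if the component of `exp(ad x)(f)` in
the summand `[f, g_{2j}]` is zero (i.e. `exp(ad x)(f)` lies in the sum of
`ker(ad e) ∩ g_{2j−2}` and all the `ad h`-eigenspaces `g_k` with `k ≠ 2j−2`),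
then `x_j = 0`. -/
theorem expAd_component_zero_implies_xj_zero
    {L : Type*} [LieRing L] [LieAlgebra ℂ L] [FiniteDimensional ℂ L]
    [LieAlgebra.IsSemisimple ℂ L]
    (h e f : L) (he : e ≠ 0)
    (hhe : ⁅h, e⁆ = (2 : ℂ) • e) (hhf : ⁅h, f⁆ = (-2 : ℂ) • f) (hef : ⁅e, f⁆ = h)
    (j m : ℤ) (hj : 2 ≤ j) (hm : j ≤ m) (c : ℂ)
    (xc : ℤ → L)
    (hxc : ∀ k ∈ Finset.Icc j m,
      xc k ∈ Module.End.eigenspace (LieAlgebra.ad ℂ L h) ((2 * k : ℤ) : ℂ))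
    (x : L) (hx : x = c • e + ∑ k ∈ Finset.Icc j m, xc k)
    (A B : Submodule ℂ L)
    (hA : A = LinearMap.ker (LieAlgebra.ad ℂ L e) ⊓
      Module.End.eigenspace (LieAlgebra.ad ℂ L h) ((2 * j - 2 : ℤ) : ℂ))
    (hB : B = Submodule.map (LieAlgebra.ad ℂ L f)
      (Module.End.eigenspace (LieAlgebra.ad ℂ L h) ((2 * j : ℤ) : ℂ))) :
    A ⊔ B = Module.End.eigenspace (LieAlgebra.ad ℂ L h) ((2 * j - 2 : ℤ) : ℂ) ∧
    A ⊓ B = ⊥ ∧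
    (expAd x f ∈ A ⊔ (⨆ (k : ℤ) (_ : k ≠ 2 * j - 2),
        Module.End.eigenspace (LieAlgebra.ad ℂ L h) ((k : ℤ) : ℂ)) → xc j = 0) := by
  have t : IsSl2Triple h e f :=
    { h_ne_zero := by
        rintro rfl
        rw [zero_lie, eq_comm, smul_eq_zero] at hhe
        exact he (hhe.resolve_left two_ne_zero)
      lie_e_f := hef
      lie_h_e_nsmul := by rw [hhe, ofNat_smul_eq_nsmul]
      lie_h_f_nsmul := by rw [hhf, neg_smul, ofNat_smul_eq_nsmul] }
  refine ⟨?_, ?_, fun hexp ↦ ?_⟩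
  · rw [hA, hB]
    exact t.ker_ad_e_sup_map_ad_f (n := 2 * j) (by lia)
  · rw [hA, hB]
    exact t.ker_ad_e_inf_map_ad_f (n := 2 * j) (by lia)
  have he2 : e ∈ adWeightSpace h 2 := mem_adWeightSpace.mpr (by simpa using hhe)
  have hf2 : f ∈ adWeightSpace h (-2) := mem_adWeightSpace.mpr (by simpa using hhf)
  have hh0 : h ∈ adWeightSpace h 0 := mem_adWeightSpace.mpr (by simp)
  set W := A ⊔ ⨆ (k : ℤ) (_ : k ≠ 2 * j - 2), adWeightSpace h k
  have le_W {k : ℤ} (hk : k ≠ 2 * j - 2) : adWeightSpace h k ≤ W :=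
    le_sup_of_le_right (le_iSup₂_of_le k hk le_rfl)
  have filtration_le_W : adWeightFiltration h (2 * j) ≤ W := iSup₂_le fun k hk ↦ le_W (by lia)
  have he_W : e ∈ W := by
    by_cases h2 : (2 : ℤ) = 2 * j - 2
    · refine Submodule.mem_sup_left ?_
      rw [hA, ← h2]
      exact ⟨by simp, he2⟩
    · exact le_W h2 he2
  have span_le_W : Submodule.span ℂ {e, h, f} ≤ W := by
    rw [Submodule.span_le]
    rintro y (rfl | rfl | rfl)
    exacts [he_W, le_W (by lia) hh0, le_W (by lia) hf2]
  have hjm : j ∈ Finset.Icc j m := Finset.mem_Icc.mpr ⟨le_rfl, hm⟩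
  have hs : ∑ k ∈ Finset.Icc j m, xc k ∈ adWeightFiltration h (2 * j) := sum_mem fun k hk ↦
    adWeightSpace_le_filtration (by have := (Finset.mem_Icc.mp hk).1; lia) (hxc k hk)
  have hlie : ⁅∑ k ∈ Finset.Icc j m, xc k, f⁆ ∈ W := by
    rw [hx] at hexp
    exact (Submodule.sub_mem_iff_right _ hexp).mp
      (sup_le span_le_W filtration_le_W (t.expAd_apply_f_sub_lie_mem c (by lia) hs))
  have hrest : ⁅∑ k ∈ (Finset.Icc j m).erase j, xc k, f⁆ ∈ W := by
    rw [sum_lie]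
    refine sum_mem fun k hk ↦ ?_
    obtain ⟨hkj, hk⟩ := Finset.mem_erase.mp hk
    exact le_W (by lia) (lie_mem_adWeightSpace (hxc k hk) hf2)
  have hlie_j : ⁅xc j, f⁆ ∈ W := by
    rw [← Finset.add_sum_erase _ _ hjm, add_lie] at hlie
    exact (Submodule.add_mem_iff_left _ hrest).mp hlie
  have hlie_A : ⁅xc j, f⁆ ∈ A :=
    mem_of_mem_sup_iSup_ne (hA.trans_le inf_le_right)
      (lie_mem_adWeightSpace (hxc j hjm) hf2) hlie_j
  have hlie_ker : ⁅e, ⁅xc j, f⁆⁆ = 0 := by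
    rw [hA] at hlie_A
    exact hlie_A.1
  refine t.eq_zero_of_lie_e_lie_f_eq_zero (k := 2 * j) (by lia)
    (mem_adWeightSpace.mp (hxc j hjm)) ?_
  rw [← lie_skew f (xc j), lie_neg, hlie_ker, neg_zero]
end

section
/- Let g be a finite-dimensional complex semisimple Lie algebra and (h, e, f) an even sl2-triple in g, i.e. the eigenspace of ad h with eigenvalue k is zero for every odd integer k. Let m be the largest integer k with g_{2k} ≠ 0, where g_{2k} is the eigenspace of ad h with eigenvalue 2k, and let V = ker(ad e). For an integer i with 1 ≤ i ≤ m, set u^i = ⨁_{k ≥ i} g_{2k} and g^{i−1} = ⨁_{k ≥ i−1} g_{2k}. Then the map from u^i × V to g sending (x, v) to exp(ad x)(f + v) is injective, and its image is exactly the affine subspace f + V + g^{i−1} = {f + v + w : v ∈ V, w ∈ g^{i−1}}. -/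
theorem expAd_zero_apply {L : Type*} [LieRing L] [LieAlgebra ℂ L] [FiniteDimensional ℂ L]
    (y : L) : expAd (0 : L) y = y := by
  simp [expAd, Finset.sum_range_succ']

namespace Module.End

variable {K M : Type*} [Field K] [CharZero K] [AddCommGroup M] [Module K M]

/-- An endomorphism of a finite-dimensional space lowering the weights of another endomorphism
is nilpotent. -/
theorem isNilpotent_of_mul_sub_mul_eq_smul [FiniteDimensional K M] {H F : Module.End K M} {c : K}
    (hc : c ≠ 0) (hHF : H * F - F * H = c • F) : IsNilpotent F := by
  have key (n : ℕ) : H * F ^ n - F ^ n * H = ((n : K) * c) • F ^ n := by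
    induction n with
    | zero => simp
    | succ n ih =>
      have : H * F ^ (n + 1) - F ^ (n + 1) * H
          = (H * F ^ n - F ^ n * H) * F + F ^ n * (H * F - F * H) := by
        rw [pow_succ]; noncomm_ring
      rw [this, ih, hHF, smul_mul_assoc, mul_smul_comm, ← pow_succ, ← add_smul]
      congr 1
      push_cast
      ring
  by_contra hF
  have hne (n : ℕ) : F ^ n ≠ 0 := fun h0 => hF ⟨n, h0⟩
  let T : Module.End K (Module.End K M) := LinearMap.mulLeft K H - LinearMap.mulRight K H
  have hT (n : ℕ) : T.HasEigenvalue ((n : K) * c) :=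
    hasEigenvalue_of_hasEigenvector (x := F ^ n)
      ⟨mem_eigenspace_iff.mpr (by simpa [T] using key n), hne n⟩
  have hinj : Function.Injective fun n : ℕ => (n : K) * c := fun a b hab => by
    simpa [hc] using hab
  exact (Set.infinite_range_of_injective hinj)
    ((finite_hasEigenvalue T).subset (Set.range_subset_iff.mpr hT))

variable {H E F : Module.End K M}

theorem apply_apply_pow_of_apply_eq_zero (hHF : H * F - F * H = (-2 : K) • F)
    (hEF : E * F - F * E = H) {v : M} (hv : E v = 0) (n : ℕ) :
    E ((F ^ (n + 1)) v) = ((n : K) + 1) • (F ^ n) (H v - (n : K) • v) := by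
  have hHF' (w : M) : H (F w) = F (H w) - (2 : K) • F w := by
    have := LinearMap.congr_fun hHF w
    simp only [LinearMap.sub_apply, mul_apply, LinearMap.smul_apply] at this
    rw [sub_eq_iff_eq_add.mp this]; module
  have hEF' (w : M) : E (F w) = F (E w) + H w := by
    rw [← hEF]; simp
  have hHn (n : ℕ) : H ((F ^ n) v) = (F ^ n) (H v) - (2 * n : K) • (F ^ n) v := by
    induction n with
    | zero => simp
    | succ n ih =>
      rw [pow_succ', mul_apply, mul_apply, hHF', ih, map_sub, map_smul]
      push_cast
      module
  induction n with
  | zero => simp [hEF', hv]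
  | succ n ih =>
    rw [pow_succ' F (n + 1), mul_apply, hEF', ih, hHn, map_smul, ← mul_apply, ← pow_succ',
      map_sub, map_sub, map_smul, map_smul]
    push_cast
    module

theorem aeval_prod_X_sub_natCast_apply_eq_zero (hHE : H * E - E * H = (2 : K) • E)
    (hHF : H * F - F * H = (-2 : K) • F) (hEF : E * F - F * E = H) (n : ℕ) {v : M}
    (hv : E v = 0) (hF : (F ^ n) v = 0) :
    Polynomial.aeval H (∏ k ∈ Finset.range n, (Polynomial.X - Polynomial.C (k : K))) v = 0 := by
  induction n generalizing v with
  | zero => simpa using hF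
  | succ n ih =>
    have hEv : E (H v - (n : K) • v) = 0 := by
      have := LinearMap.congr_fun hHE v
      simp only [LinearMap.sub_apply, mul_apply, LinearMap.smul_apply, hv, map_zero,
        smul_zero, zero_sub, neg_eq_zero] at this
      simp [this, hv]
    have hFv : (F ^ n) (H v - (n : K) • v) = 0 := by
      have := apply_apply_pow_of_apply_eq_zero hHF hEF hv n
      rw [hF, map_zero, eq_comm, smul_eq_zero] at this
      exact this.resolve_left n.cast_add_one_ne_zero
    rw [Finset.prod_range_succ, map_mul, mul_apply]
    simpa [← Nat.cast_smul_eq_nsmul K] using ih hEv hFv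

theorem ker_aeval_prod_X_sub_natCast_le (n : ℕ) :
    LinearMap.ker (Polynomial.aeval H
      (∏ k ∈ Finset.range n, (Polynomial.X - Polynomial.C (k : K)))) ≤
      ⨆ k : ℕ, eigenspace H (k : K) := by
  induction n with
  | zero =>
    intro v hv
    have : v = 0 := by simpa using hv
    simp [this]
  | succ n ih =>
    rw [Finset.prod_range_succ, ← Polynomial.sup_ker_aeval_eq_ker_aeval_mul_of_coprime]
    · refine sup_le ih (le_trans (le_of_eq ?_) (le_iSup _ n))
      ext v
      simp [sub_eq_zero, Nat.cast_smul_eq_nsmul]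
    · refine IsCoprime.prod_left fun k hk => Polynomial.isCoprime_X_sub_C_of_isUnit_sub ?_
      rw [Finset.mem_range] at hk
      exact (sub_ne_zero.mpr (by exact_mod_cast hk.ne)).isUnit

/-- In a finite-dimensional representation of `sl₂`, the kernel of the raising operator is spanned
by weight vectors whose weights are natural numbers. -/
theorem ker_le_iSup_eigenspace_natCast [FiniteDimensional K M]
    (hHE : H * E - E * H = (2 : K) • E)
    (hHF : H * F - F * H = (-2 : K) • F) (hEF : E * F - F * E = H) :
    LinearMap.ker E ≤ ⨆ k : ℕ, eigenspace H (k : K) := by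
  intro v hv
  obtain ⟨n, hn⟩ := isNilpotent_of_mul_sub_mul_eq_smul (by norm_num) hHF
  exact ker_aeval_prod_X_sub_natCast_le n
    (aeval_prod_X_sub_natCast_apply_eq_zero hHE hHF hEF n hv (by simp [hn]))

theorem apply_pow_succ_of_apply_apply_eq_zero (hHE : H * E - E * H = (2 : K) • E)
    (hEF : E * F - F * E = H) {c : K} {z : M} (hz : H z = c • z) (hEFz : E (F z) = 0) (n : ℕ) :
    F ((E ^ (n + 1)) z) = (-((n + 1 : K) * (c + n))) • (E ^ n) z := by
  have hHE' (w : M) : H (E w) = E (H w) + (2 : K) • E w := by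
    have := LinearMap.congr_fun hHE w
    simp only [LinearMap.sub_apply, mul_apply, LinearMap.smul_apply] at this
    rw [sub_eq_iff_eq_add.mp this]; module
  have hFE' (w : M) : F (E w) = E (F w) - H w := by
    rw [← hEF]; simp
  have hHn (n : ℕ) : H ((E ^ n) z) = (c + 2 * n) • (E ^ n) z := by
    induction n with
    | zero => simp [hz]
    | succ n ih =>
      rw [pow_succ', mul_apply, hHE', ih, map_smul]
      push_cast
      module
  induction n with
  | zero => simp [hFE', hz, hEFz]
  | succ n ih =>
    rw [pow_succ' E (n + 1), mul_apply, hFE', ih, hHn, map_smul, ← mul_apply, ← pow_succ']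
    push_cast
    module

theorem eq_zero_of_apply_apply_eq_zero (hHE : H * E - E * H = (2 : K) • E)
    (hEF : E * F - F * E = H) {c : K} (hc : ∀ n : ℕ, c + n ≠ 0) {z : M} (hz : H z = c • z)
    (hEFz : E (F z) = 0) (n : ℕ) (hn : (E ^ n) z = 0) : z = 0 := by
  induction n with
  | zero => simpa using hn
  | succ n ih =>
    have := apply_pow_succ_of_apply_apply_eq_zero hHE hEF hz hEFz n
    rw [hn, map_zero, eq_comm, smul_eq_zero, neg_eq_zero, mul_eq_zero] at this
    exact ih (this.resolve_left (not_or.mpr ⟨n.cast_add_one_ne_zero, hc n⟩))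

end Module.End

/-- The decreasing filtration `k ↦ ⨁_{j ≥ k} g_{2j}` attached to the even part of the
`ad h`-grading. -/
noncomputable def evenFiltration {L : Type*} [LieRing L] [LieAlgebra ℂ L] (h : L) (k : ℤ) :
    Submodule ℂ L :=
  ⨆ (j : ℤ) (_ : k ≤ j), Module.End.eigenspace (LieAlgebra.ad ℂ L h) ((2 * j : ℤ) : ℂ)

namespace evenFiltration

open LieAlgebra Module.End

variable {L : Type*} [LieRing L] [LieAlgebra ℂ L] {h e f : L}

theorem antitone : Antitone (evenFiltration h) := fun _ _ hab =>
  iSup₂_le fun j hj => le_iSup₂_of_le j (hab.trans hj) le_rfl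

theorem mem_of_lie_eq {k : ℤ} {x : L} (hx : ⁅h, x⁆ = ((2 * k : ℤ) : ℂ) • x) :
    x ∈ evenFiltration h k :=
  le_iSup₂ (f := fun (j : ℤ) (_ : k ≤ j) => eigenspace (ad ℂ L h) ((2 * j : ℤ) : ℂ)) k le_rfl
    (mem_eigenspace_iff.mpr hx)

theorem lie_mem {a b : ℤ} {x y : L} (hx : x ∈ evenFiltration h a)
    (hy : y ∈ evenFiltration h b) : ⁅x, y⁆ ∈ evenFiltration h (a + b) := by
  suffices hsuff : evenFiltration h a ≤ ((evenFiltration h (a + b)).comap (ad ℂ L y)) by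
    rw [← lie_skew, neg_mem_iff]
    exact hsuff hx
  refine iSup₂_le fun j hj x hx => ?_
  rw [Submodule.mem_comap, ad_apply, ← lie_skew, neg_mem_iff]
  suffices hsuff : evenFiltration h b ≤ ((evenFiltration h (a + b)).comap (ad ℂ L x)) by
    simpa using hsuff hy
  refine iSup₂_le fun l hl y hy => ?_
  rw [mem_eigenspace_iff, ad_apply] at hx hy
  refine antitone (add_le_add hj hl) (mem_of_lie_eq ?_)
  rw [ad_apply, leibniz_lie, hx, hy, smul_lie, lie_smul]
  push_cast
  module

theorem eq_bot {m k : ℤ} (hm : ∀ k : ℤ, m < k →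
    eigenspace (ad ℂ L h) ((2 * k : ℤ) : ℂ) = ⊥) (hk : m < k) : evenFiltration h k = ⊥ :=
  le_bot_iff.mp (iSup₂_le fun j hj => (hm j (hk.trans_le hj)).le)

theorem ad_pow_mem {x y : L} (hx : x ∈ evenFiltration h 1) {j : ℤ}
    (hy : y ∈ evenFiltration h j) (n : ℕ) : (ad ℂ L x ^ n) y ∈ evenFiltration h (j + n) := by
  induction n with
  | zero => simpa using hy
  | succ n ih =>
    rw [pow_succ', mul_apply]
    refine antitone (le_of_eq ?_) (lie_mem hx ih)
    push_cast
    ring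

theorem ad_pow_sub_ad_pow_mem {x₁ x₂ y : L} (hx₁ : x₁ ∈ evenFiltration h 1)
    (hx₂ : x₂ ∈ evenFiltration h 1) {k j : ℤ} (hx : x₂ - x₁ ∈ evenFiltration h (k + 1))
    (hy : y ∈ evenFiltration h j) (n : ℕ) :
    (ad ℂ L x₂ ^ n) y - (ad ℂ L x₁ ^ n) y ∈ evenFiltration h (j + k + n) := by
  induction n with
  | zero => simp
  | succ n ih =>
    have hsplit : (ad ℂ L x₂ ^ (n + 1)) y - (ad ℂ L x₁ ^ (n + 1)) y =
        ⁅x₂, (ad ℂ L x₂ ^ n) y - (ad ℂ L x₁ ^ n) y⁆ + ⁅x₂ - x₁, (ad ℂ L x₁ ^ n) y⁆ := by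
      simp only [pow_succ', mul_apply, ad_apply, lie_sub, sub_lie]
      abel
    rw [hsplit]
    refine add_mem (antitone (le_of_eq ?_) (lie_mem hx₂ ih))
      (antitone (le_of_eq ?_) (lie_mem hx (ad_pow_mem hx₁ hy n))) <;>
    · push_cast
      ring

/-- The leading term of the variation of `(x, v) ↦ exp (ad x) (f + v)`. -/
theorem expAd_sub_expAd_sub_mem [FiniteDimensional ℂ L] [Nontrivial L]
    (hf : f ∈ evenFiltration h (-1)) {x₁ x₂ v₁ v₂ : L}
    (hx₁ : x₁ ∈ evenFiltration h 1) (hx₂ : x₂ ∈ evenFiltration h 1)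
    (hv₂ : v₂ ∈ evenFiltration h 0) {k : ℤ}
    (hx : x₂ - x₁ ∈ evenFiltration h (k + 1)) (hv : v₂ - v₁ ∈ evenFiltration h k) :
    expAd x₂ (f + v₂) - expAd x₁ (f + v₁) - (⁅x₂ - x₁, f⁆ + (v₂ - v₁)) ∈
      evenFiltration h (k + 1) := by
  have hterm_v (n : ℕ) : (ad ℂ L x₂ ^ (n + 1)) v₂ - (ad ℂ L x₁ ^ (n + 1)) v₁ ∈
      evenFiltration h (k + 1) := by
    have hsplit : (ad ℂ L x₂ ^ (n + 1)) v₂ - (ad ℂ L x₁ ^ (n + 1)) v₁ =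
        ((ad ℂ L x₂ ^ (n + 1)) v₂ - (ad ℂ L x₁ ^ (n + 1)) v₂) +
          (ad ℂ L x₁ ^ (n + 1)) (v₂ - v₁) := by
      rw [map_sub]
      abel
    rw [hsplit]
    refine add_mem (antitone ?_ (ad_pow_sub_ad_pow_mem hx₁ hx₂ hx hv₂ (n + 1)))
      (antitone ?_ (ad_pow_mem hx₁ hv (n + 1))) <;>
    · push_cast
      lia
  have hterm_f (n : ℕ) : (ad ℂ L x₂ ^ (n + 2)) f - (ad ℂ L x₁ ^ (n + 2)) f ∈
      evenFiltration h (k + 1) := by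
    refine antitone ?_ (ad_pow_sub_ad_pow_mem hx₁ hx₂ hx hf (n + 2))
    push_cast
    lia
  obtain ⟨N, hN⟩ := Nat.exists_eq_succ_of_ne_zero (Module.finrank_pos (R := ℂ) (M := L)).ne'
  have hexp (x y : L) : expAd x y = y + ⁅x, y⁆ +
      ∑ n ∈ Finset.range N, ((n + 2).factorial : ℂ)⁻¹ • (ad ℂ L x ^ (n + 2)) y := by
    simp only [expAd, hN, Finset.sum_range_succ', LinearMap.add_apply, LinearMap.sum_apply,
      LinearMap.smul_apply]
    simp
    abel
  have hsplit : expAd x₂ (f + v₂) - expAd x₁ (f + v₁) - (⁅x₂ - x₁, f⁆ + (v₂ - v₁)) =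
      ((ad ℂ L x₂ ^ (0 + 1)) v₂ - (ad ℂ L x₁ ^ (0 + 1)) v₁) +
        ∑ n ∈ Finset.range N, ((n + 2).factorial : ℂ)⁻¹ •
          (((ad ℂ L x₂ ^ (n + 2)) f - (ad ℂ L x₁ ^ (n + 2)) f) +
            ((ad ℂ L x₂ ^ (n + 1 + 1)) v₂ - (ad ℂ L x₁ ^ (n + 1 + 1)) v₁)) := by
    simp only [hexp, map_add, smul_add, smul_sub, Finset.sum_add_distrib, Finset.sum_sub_distrib,
      lie_add, sub_lie, zero_add, pow_one, ad_apply]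
    abel
  rw [hsplit]
  exact add_mem (hterm_v 0) (sum_mem fun n _ =>
    Submodule.smul_mem _ _ (add_mem (hterm_f n) (hterm_v (n + 1))))

theorem ad_mul_ad_sub {x y z : L} (hxy : ⁅x, y⁆ = z) :
    ad ℂ L x * ad ℂ L y - ad ℂ L y * ad ℂ L x = ad ℂ L z := by
  ext w
  simp [← hxy]

theorem ker_ad_le [FiniteDimensional ℂ L]
    (hhe : ⁅h, e⁆ = (2 : ℂ) • e) (hhf : ⁅h, f⁆ = (-2 : ℂ) • f) (hef : ⁅e, f⁆ = h)
    (heven : ∀ k : ℤ, Odd k → eigenspace (ad ℂ L h) ((k : ℤ) : ℂ) = ⊥) :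
    LinearMap.ker (ad ℂ L e) ≤ evenFiltration h 0 := by
  have hHE := ad_mul_ad_sub hhe
  have hHF := ad_mul_ad_sub hhf
  rw [map_smul] at hHE hHF
  refine (ker_le_iSup_eigenspace_natCast hHE hHF (ad_mul_ad_sub hef)).trans
    (iSup_le fun k => ?_)
  obtain ⟨j, rfl⟩ | hk := Nat.even_or_odd k
  · refine le_iSup₂_of_le (j : ℤ) (Int.natCast_nonneg j) (le_of_eq ?_)
    congr 1
    push_cast
    ring
  · have := heven k (by exact_mod_cast hk)
    rw [Int.cast_natCast] at this
    simp [this]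

theorem le_map_ad_mul_ad [FiniteDimensional ℂ L]
    (hhe : ⁅h, e⁆ = (2 : ℂ) • e) (hhf : ⁅h, f⁆ = (-2 : ℂ) • f) (hef : ⁅e, f⁆ = h)
    {m : ℤ} (hm : ∀ k : ℤ, m < k → eigenspace (ad ℂ L h) ((2 * k : ℤ) : ℂ) = ⊥)
    {k : ℤ} (hk : 1 ≤ k) :
    evenFiltration h k ≤ (evenFiltration h k).map (ad ℂ L e * ad ℂ L f) := by
  have hHE := ad_mul_ad_sub hhe
  rw [map_smul] at hHE
  refine iSup₂_le fun j hj => ?_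
  set W := eigenspace (ad ℂ L h) ((2 * j : ℤ) : ℂ) with hW
  have hWle : W ≤ evenFiltration h k := le_iSup₂_of_le j hj le_rfl
  have hmaps : ∀ z ∈ W, (ad ℂ L e * ad ℂ L f) z ∈ W := fun z hz => by
    rw [hW, mem_eigenspace_iff, ad_apply] at hz ⊢
    simp only [mul_apply, ad_apply, leibniz_lie h, hhe, hhf, hz, smul_lie, lie_smul, lie_add]
    module
  have hinj : Function.Injective ((ad ℂ L e * ad ℂ L f).restrict hmaps) := by
    rw [injective_iff_map_eq_zero]
    rintro ⟨z, hz⟩ hz0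
    replace hz0 : ad ℂ L e (ad ℂ L f z) = 0 := congrArg Subtype.val hz0
    refine Subtype.ext (eq_zero_of_apply_apply_eq_zero hHE (ad_mul_ad_sub hef) (fun n => ?_)
      (mem_eigenspace_iff.mp hz) hz0 (m.toNat + 1) ?_)
    · have : (2 * j + n : ℤ) ≠ 0 := by lia
      exact_mod_cast this
    · have he : e ∈ evenFiltration h 1 := mem_of_lie_eq (by simpa using hhe)
      have := ad_pow_mem he (mem_of_lie_eq (mem_eigenspace_iff.mp hz)) (m.toNat + 1)
      rwa [eq_bot hm (by push_cast; lia), Submodule.mem_bot] at this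
  intro y hy
  obtain ⟨z, hz⟩ := LinearMap.injective_iff_surjective.mp hinj ⟨y, hy⟩
  exact ⟨z, hWle z.2, congrArg Subtype.val hz⟩

theorem injOn_ad_mul_ad [FiniteDimensional ℂ L]
    (hhe : ⁅h, e⁆ = (2 : ℂ) • e) (hhf : ⁅h, f⁆ = (-2 : ℂ) • f) (hef : ⁅e, f⁆ = h)
    {m : ℤ} (hm : ∀ k : ℤ, m < k → eigenspace (ad ℂ L h) ((2 * k : ℤ) : ℂ) = ⊥) :
    Set.InjOn (ad ℂ L e * ad ℂ L f) (evenFiltration h 1) := by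
  have he : e ∈ evenFiltration h 1 := mem_of_lie_eq (by simpa using hhe)
  have hf : f ∈ evenFiltration h (-1) := mem_of_lie_eq (by simpa using hhf)
  have hmaps : ∀ z ∈ evenFiltration h 1, (ad ℂ L e * ad ℂ L f) z ∈ evenFiltration h 1 :=
    fun z hz => antitone (by simp) (lie_mem he (lie_mem hf hz))
  have hsurj : Function.Surjective ((ad ℂ L e * ad ℂ L f).restrict hmaps) := fun y => by
    obtain ⟨z, hz, hzy⟩ := le_map_ad_mul_ad hhe hhf hef hm le_rfl y.2
    exact ⟨⟨z, hz⟩, Subtype.ext hzy⟩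
  intro y hy z hz hyz
  exact congrArg Subtype.val (LinearMap.injective_iff_surjective.mpr hsurj
    (a₁ := ⟨y, hy⟩) (a₂ := ⟨z, hz⟩) (Subtype.ext hyz))

end evenFiltration

/-- Lynch's generalization of Kostant's theorem, algebraic form.
Let `(h, e, f)` be an even sl2-triple in a finite-dimensional complex semisimple Lie
algebra, `m` the largest integer with `g_{2m} ≠ 0`, `V = ker(ad e)`, and for `1 ≤ i ≤ m`
set `u^i = ⨁_{k ≥ i} g_{2k}` and `g^{i−1} = ⨁_{k ≥ i−1} g_{2k}`.  Then the map
`u^i × V → g, (x, v) ↦ exp(ad x)(f + v)` is injective with image exactly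
`f + V + g^{i−1}`. -/
theorem expAd_slodowy_slice_bijection
    {L : Type*} [LieRing L] [LieAlgebra ℂ L] [FiniteDimensional ℂ L]
    [LieAlgebra.IsSemisimple ℂ L]
    (h e f : L) (he : e ≠ 0)
    (hhe : ⁅h, e⁆ = (2 : ℂ) • e) (hhf : ⁅h, f⁆ = (-2 : ℂ) • f) (hef : ⁅e, f⁆ = h)
    (heven : ∀ k : ℤ, Odd k →
      Module.End.eigenspace (LieAlgebra.ad ℂ L h) ((k : ℤ) : ℂ) = ⊥)
    (m : ℤ)
    (hm1 : Module.End.eigenspace (LieAlgebra.ad ℂ L h) ((2 * m : ℤ) : ℂ) ≠ ⊥)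
    (hm2 : ∀ k : ℤ, m < k →
      Module.End.eigenspace (LieAlgebra.ad ℂ L h) ((2 * k : ℤ) : ℂ) = ⊥)
    (i : ℤ) (hi1 : 1 ≤ i) (hi2 : i ≤ m)
    (uI gI : Submodule ℂ L)
    (huI : uI = ⨆ (k : ℤ) (_ : i ≤ k),
      Module.End.eigenspace (LieAlgebra.ad ℂ L h) ((2 * k : ℤ) : ℂ))
    (hgI : gI = ⨆ (k : ℤ) (_ : i - 1 ≤ k),
      Module.End.eigenspace (LieAlgebra.ad ℂ L h) ((2 * k : ℤ) : ℂ)) :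
    (∀ x₁ ∈ uI, ∀ v₁ ∈ LinearMap.ker (LieAlgebra.ad ℂ L e),
      ∀ x₂ ∈ uI, ∀ v₂ ∈ LinearMap.ker (LieAlgebra.ad ℂ L e),
        expAd x₁ (f + v₁) = expAd x₂ (f + v₂) → x₁ = x₂ ∧ v₁ = v₂) ∧
    (∀ x ∈ uI, ∀ v ∈ LinearMap.ker (LieAlgebra.ad ℂ L e),
      ∃ v' ∈ LinearMap.ker (LieAlgebra.ad ℂ L e), ∃ w ∈ gI,
        expAd x (f + v) = f + v' + w) ∧
    (∀ v ∈ LinearMap.ker (LieAlgebra.ad ℂ L e), ∀ w ∈ gI,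
      ∃ x ∈ uI, ∃ v' ∈ LinearMap.ker (LieAlgebra.ad ℂ L e),
        expAd x (f + v') = f + v + w) := by
  have : Nontrivial L := ⟨e, 0, he⟩
  change uI = evenFiltration h i at huI
  change gI = evenFiltration h (i - 1) at hgI
  subst huI hgI
  have heF : e ∈ evenFiltration h 1 := evenFiltration.mem_of_lie_eq (by simpa using hhe)
  have hfF : f ∈ evenFiltration h (-1) := evenFiltration.mem_of_lie_eq (by simpa using hhf)
  have hV := evenFiltration.ker_ad_le hhe hhf hef heven
  have hbot : evenFiltration h (m + 1) = ⊥ := evenFiltration.eq_bot hm2 (lt_add_one m)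
  have hU : evenFiltration h i ≤ evenFiltration h 1 := evenFiltration.antitone hi1
  have himage : ∀ x ∈ evenFiltration h i, ∀ v ∈ LinearMap.ker (LieAlgebra.ad ℂ L e),
      expAd x (f + v) - (f + v) ∈ evenFiltration h (i - 1) := by
    intro x hx v hv
    have hlead := evenFiltration.expAd_sub_expAd_sub_mem (v₁ := v) (k := i - 1) hfF
      (zero_mem _) (hU hx) (hV hv) (by simpa using hx) (by simp)
    rw [expAd_zero_apply, sub_self, add_zero, sub_zero] at hlead
    have hxf : ⁅x, f⁆ ∈ evenFiltration h (i - 1) := evenFiltration.lie_mem hx hfF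
    simpa using add_mem (evenFiltration.antitone (by simp) hlead) hxf
  refine ⟨fun x₁ hx₁ v₁ hv₁ x₂ hx₂ v₂ hv₂ heq => ?_, fun x hx v hv => ?_, fun v hv w hw => ?_⟩
  · have hdiff : ∀ k : ℤ, i - 1 ≤ k →
        x₂ - x₁ ∈ evenFiltration h (k + 1) ∧ v₂ - v₁ ∈ evenFiltration h k := by
      intro k hk
      induction k, hk using Int.leInduction with
      | base =>
        refine ⟨by simpa using sub_mem hx₂ hx₁, ?_⟩
        have hsub := sub_mem (himage x₁ hx₁ v₁ hv₁) (himage x₂ hx₂ v₂ hv₂)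
        rwa [heq, sub_sub_sub_cancel_left, add_sub_add_left_eq_sub] at hsub
      | succ k hk ih =>
        obtain ⟨hx, hv⟩ := ih
        have hlead := evenFiltration.expAd_sub_expAd_sub_mem hfF (hU hx₁) (hU hx₂) (hV hv₂) hx hv
        rw [heq, sub_self, zero_sub, neg_mem_iff] at hlead
        have hker : ⁅e, v₂ - v₁⁆ = 0 := sub_mem hv₂ hv₁
        have hefx : ⁅e, ⁅f, x₂ - x₁⁆⁆ ∈ evenFiltration h (k + 1 + 1) := by
          have hlie := evenFiltration.lie_mem heF hlead
          rw [lie_add, hker, add_zero, ← lie_skew (x₂ - x₁) f, lie_neg, neg_mem_iff] at hlie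
          exact evenFiltration.antitone (by lia) hlie
        obtain ⟨z, hz, hzx⟩ := evenFiltration.le_map_ad_mul_ad hhe hhf hef hm2 (by lia) hefx
        have hzeq : z = x₂ - x₁ := evenFiltration.injOn_ad_mul_ad hhe hhf hef hm2
          (evenFiltration.antitone (by lia) hz) (evenFiltration.antitone (by lia) hx) hzx
        rw [hzeq] at hz
        have hxf : ⁅x₂ - x₁, f⁆ ∈ evenFiltration h (k + 1) :=
          evenFiltration.antitone (by lia) (evenFiltration.lie_mem hz hfF)
        exact ⟨hz, (Submodule.add_mem_iff_right _ hxf).mp hlead⟩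
    have hx := (hdiff m (by lia)).1
    have hv := (hdiff (m + 1) (by lia)).2
    rw [hbot, Submodule.mem_bot, sub_eq_zero] at hx hv
    exact ⟨hx.symm, hv.symm⟩
  · exact ⟨v, hv, _, himage x hx v hv, by abel⟩
  · have happrox : ∀ k : ℤ, i - 1 ≤ k → ∃ x ∈ evenFiltration h i,
        ∃ v' ∈ LinearMap.ker (LieAlgebra.ad ℂ L e),
          f + v + w - expAd x (f + v') ∈ evenFiltration h k := by
      intro k hk
      induction k, hk using Int.leInduction with
      | base => exact ⟨0, zero_mem _, v, hv, by simpa [expAd_zero_apply] using hw⟩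
      | succ k hk ih =>
        obtain ⟨x, hx, v', hv', hd⟩ := ih
        have hed : ⁅e, f + v + w - expAd x (f + v')⁆ ∈ evenFiltration h (k + 1) :=
          evenFiltration.antitone (by lia) (evenFiltration.lie_mem heF hd)
        obtain ⟨z, hz, hzd⟩ :=
          evenFiltration.le_map_ad_mul_ad hhe hhf hef hm2 (by lia) hed
        rw [Module.End.mul_apply, LieAlgebra.ad_apply, LieAlgebra.ad_apply] at hzd
        set d := f + v + w - expAd x (f + v') with hd_def
        have hfz : ⁅f, z⁆ ∈ evenFiltration h k :=
          evenFiltration.antitone (by lia) (evenFiltration.lie_mem hfF hz)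
        have hu : d - ⁅f, z⁆ ∈ LinearMap.ker (LieAlgebra.ad ℂ L e) := by
          rw [LinearMap.mem_ker, LieAlgebra.ad_apply, lie_sub, hzd, sub_self]
        have hx' : x - z ∈ evenFiltration h i :=
          sub_mem hx (evenFiltration.antitone (by lia) hz)
        refine ⟨x - z, hx', v' + (d - ⁅f, z⁆), add_mem hv' hu, ?_⟩
        have hlead := evenFiltration.expAd_sub_expAd_sub_mem (x₁ := x) (x₂ := x - z) (v₁ := v')
          (v₂ := v' + (d - ⁅f, z⁆)) (k := k) hfF (hU hx) (hU hx') (hV (add_mem hv' hu))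
          (by simpa using hz) (by simpa using sub_mem hd hfz)
        rw [sub_sub_cancel_left, neg_lie, lie_skew, add_sub_cancel_left,
          add_sub_cancel] at hlead
        rw [← neg_mem_iff]
        convert hlead using 1
        rw [hd_def]
        abel
    obtain ⟨x, hx, v', hv', hd⟩ := happrox (m + 1) (by lia)
    rw [hbot, Submodule.mem_bot, sub_eq_zero] at hd
    exact ⟨x, hx, v', hv', hd.symm⟩
end

section
/- Let g be a finite-dimensional complex semisimple Lie algebra and (h, e, f) an sl2-triple in g. If the eigenspace of ad h with eigenvalue 1 is zero, then the eigenspace of ad h with eigenvalue k is zero for every odd integer k. -/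
namespace IsSl2Triple

variable {R L M : Type*} [CommRing R] [LieRing L] [LieAlgebra R L]
  [AddCommGroup M] [Module R M] [LieRingModule L M] [LieModule R L M] {h e f : L} {m : M}

/-- The lowering operator shifts the eigenvalue of `h` by `-2`. -/
lemma lie_h_lie_f (t : IsSl2Triple h e f) {μ : R} (hm : ⁅h, m⁆ = μ • m) :
    ⁅h, ⁅f, m⁆⁆ = (μ - 2) • ⁅f, m⁆ := by
  rw [leibniz_lie h, t.lie_lie_smul_f R, hm, neg_lie, smul_lie, lie_smul, sub_smul]
  abel

variable [IsDomain R] [CharZero R] [IsNoetherian R M] [Module.IsTorsionFree R M]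

/-- The lowering operator is injective on the eigenspaces of `h` with positive eigenvalue. -/
lemma eq_zero_of_lie_f_eq_zero (t : IsSl2Triple h e f) {n : ℕ}
    (hm : ⁅h, m⁆ = ((n : R) + 1) • m) (hf : ⁅f, m⁆ = 0) : m = 0 := by
  by_contra hne
  have P : t.symm.HasPrimitiveVectorWith m (-((n : R) + 1)) :=
    { ne_zero := hne
      lie_h := by rw [neg_lie, hm, neg_smul]
      lie_e := hf }
  obtain ⟨k, hk⟩ := P.exists_nat
  have hsum : ((k + n + 1 : ℕ) : R) = 0 := by
    push_cast
    rw [← hk]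
    ring
  exact Nat.succ_ne_zero _ (Nat.cast_eq_zero.mp hsum)

/-- If `1` is not an eigenvalue of `h`, then neither is any positive odd number. -/
lemma eq_zero_of_lie_h_eq_odd_smul (t : IsSl2Triple h e f)
    (h1 : ∀ m : M, ⁅h, m⁆ = m → m = 0) (n : ℕ) {m : M}
    (hm : ⁅h, m⁆ = (2 * (n : R) + 1) • m) : m = 0 := by
  induction n generalizing m with
  | zero => exact h1 m (by simpa using hm)
  | succ n ih =>
    refine t.eq_zero_of_lie_f_eq_zero (R := R) (n := 2 * (n + 1)) (by simpa using hm) (ih ?_)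
    rw [t.lie_h_lie_f hm]
    congr 1
    push_cast
    ring

/-- If `1` is not an eigenvalue of `h`, then neither is `-1`. -/
lemma eq_zero_of_lie_h_eq_neg (t : IsSl2Triple h e f)
    (h1 : ∀ m : M, ⁅h, m⁆ = m → m = 0) (hm : ⁅h, m⁆ = (-1 : R) • m) : m = 0 := by
  have hm' : ⁅-h, m⁆ = (1 : R) • m := by rw [neg_lie, hm, neg_smul, neg_neg]
  refine t.symm.eq_zero_of_lie_f_eq_zero (R := R) (n := 0) (by simpa using hm') (h1 _ ?_)
  have hlie := t.symm.lie_h_lie_f hm'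
  rw [neg_lie, neg_eq_iff_eq_neg] at hlie
  rw [hlie, ← neg_smul]
  norm_num

end IsSl2Triple

/-- Let `(h, e, f)` be an sl2-triple in a finite-dimensional complex
semisimple Lie algebra.  If the eigenspace of `ad h` with eigenvalue `1` is zero, then the
eigenspace of `ad h` with eigenvalue `k` is zero for every odd integer `k`. -/
theorem odd_eigenspaces_eq_bot_of_eigenspace_one_eq_bot
    {L : Type*} [LieRing L] [LieAlgebra ℂ L] [FiniteDimensional ℂ L]
    [LieAlgebra.IsSemisimple ℂ L]
    (h e f : L) (he : e ≠ 0)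
    (hhe : ⁅h, e⁆ = (2 : ℂ) • e) (hhf : ⁅h, f⁆ = (-2 : ℂ) • f) (hef : ⁅e, f⁆ = h)
    (h1 : Module.End.eigenspace (LieAlgebra.ad ℂ L h) (1 : ℂ) = ⊥) :
    ∀ k : ℤ, Odd k →
      Module.End.eigenspace (LieAlgebra.ad ℂ L h) ((k : ℤ) : ℂ) = ⊥ := by
  have t : IsSl2Triple h e f :=
    { h_ne_zero := by
        rintro rfl
        rw [zero_lie, eq_comm, smul_eq_zero] at hhe
        exact hhe.elim two_ne_zero he
      lie_e_f := hef
      lie_h_e_nsmul := by rw [hhe, two_smul, two_smul]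
      lie_h_f_nsmul := by rw [hhf, neg_smul, two_smul, two_smul] }
  have h_one : ∀ m : L, ⁅h, m⁆ = m → m = 0 := fun m hm ↦ by
    rw [← Submodule.mem_bot ℂ, ← h1, Module.End.mem_eigenspace_iff]
    simpa using hm
  have h_neg_one : ∀ m : L, ⁅-h, m⁆ = m → m = 0 := fun m hm ↦
    t.eq_zero_of_lie_h_eq_neg (R := ℂ) h_one (by
      rw [neg_one_smul, ← neg_eq_iff_eq_neg, ← neg_lie, hm])
  intro k hk
  rw [Submodule.eq_bot_iff]
  intro m hm
  rw [Module.End.mem_eigenspace_iff, LieAlgebra.ad_apply] at hm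
  obtain ⟨j, rfl⟩ := hk
  obtain ⟨n, rfl | rfl⟩ : ∃ n : ℕ, j = n ∨ j = -(n : ℤ) - 1 := by
    rcases le_or_gt 0 j with hj | hj
    · exact ⟨j.toNat, by omega⟩
    · exact ⟨(-j - 1).toNat, by omega⟩
  · exact t.eq_zero_of_lie_h_eq_odd_smul (R := ℂ) h_one n (by simpa using hm)
  · refine t.symm.eq_zero_of_lie_h_eq_odd_smul (R := ℂ) h_neg_one n ?_
    rw [neg_lie, hm, ← neg_smul]
    congr 1
    push_cast
    ring
end

section
/- Let g be a finite-dimensional complex semisimple Lie algebra and (h, e, f) an sl2-triple in g. Then the endomorphism ad h of g is diagonalizable with integer eigenvalues: g is the internal direct sum of the eigenspaces of ad h, and every eigenvalue of ad h on g is an integer. -/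
namespace IsSl2Triple

open LieModule Module Polynomial

variable {K L M : Type*} [Field K] [LieRing L] [LieAlgebra K L]
  [AddCommGroup M] [Module K M] [LieRingModule L M] [LieModule K L M] {h e f : L}

lemma lie_f_mem_maxGenEigenspace (t : IsSl2Triple h e f) {μ : K} {w : M}
    (hw : w ∈ (toEnd K L M h).maxGenEigenspace μ) :
    ⁅f, w⁆ ∈ (toEnd K L M h).maxGenEigenspace (μ - 2) := by
  rw [End.mem_maxGenEigenspace] at hw ⊢
  obtain ⟨k, hk⟩ := hw
  have hs : SemiconjBy (toEnd K L M f) (toEnd K L M h - μ • 1)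
      (toEnd K L M h - (μ - 2) • 1) := by
    refine LinearMap.ext fun x ↦ ?_
    simp only [End.mul_apply, LinearMap.sub_apply, LinearMap.smul_apply, End.one_apply,
      toEnd_apply_apply, lie_sub, lie_smul, leibniz_lie h, t.lie_lie_smul_f K, neg_lie, smul_lie]
    module
  refine ⟨k, ?_⟩
  have := LinearMap.congr_fun (hs.pow_right k) w
  simpa [hk] using this.symm

lemma pow_toEnd_f_mem_maxGenEigenspace (t : IsSl2Triple h e f) {μ : K} {w : M}
    (hw : w ∈ (toEnd K L M h).maxGenEigenspace μ) (n : ℕ) :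
    (toEnd K L M f ^ n) w ∈ (toEnd K L M h).maxGenEigenspace (μ - 2 * n) := by
  induction n with
  | zero => simpa using hw
  | succ n ih =>
    have := t.lie_f_mem_maxGenEigenspace ih
    rw [pow_succ', End.mul_apply, toEnd_apply_apply]
    convert this using 2
    push_cast
    ring

lemma lie_pow_toEnd_f (t : IsSl2Triple h e f) (w : M) (n : ℕ) :
    ⁅h, (toEnd K L M f ^ n) w⁆ =
      (toEnd K L M f ^ n) ⁅h, w⁆ - (2 * n : K) • (toEnd K L M f ^ n) w := by
  induction n with
  | zero => simp
  | succ n ih =>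
    simp only [pow_succ', End.mul_apply, toEnd_apply_apply, leibniz_lie h f,
      t.lie_lie_smul_f K, ih, neg_lie, smul_lie, lie_sub, lie_smul]
    push_cast
    module

lemma lie_e_pow_succ_toEnd_f_of_lie_e_eq_zero (t : IsSl2Triple h e f) {w : M}
    (hw : ⁅e, w⁆ = 0) (n : ℕ) :
    ⁅e, (toEnd K L M f ^ (n + 1)) w⁆ =
      (n + 1 : K) • (toEnd K L M f ^ n) (⁅h, w⁆ - (n : K) • w) := by
  induction n with
  | zero => simp [leibniz_lie e f, t.lie_e_f, hw]
  | succ n ih =>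
    rw [pow_succ', End.mul_apply, toEnd_apply_apply, leibniz_lie e f, t.lie_e_f, ih,
      t.lie_pow_toEnd_f, lie_smul]
    simp only [pow_succ', End.mul_apply, toEnd_apply_apply, map_sub, map_smul, lie_sub, lie_smul]
    push_cast
    module

lemma lie_e_sub_smul_eq_zero (t : IsSl2Triple h e f) {w : M} (hw : ⁅e, w⁆ = 0) (c : K) :
    ⁅e, ⁅h, w⁆ - c • w⁆ = 0 := by
  have h1 := leibniz_lie h e w
  rw [t.lie_h_e_smul K, smul_lie, hw] at h1
  simpa [hw] using h1.symm

lemma pow_toEnd_e_pow_toEnd_f (t : IsSl2Triple h e f) {w : M} (hw : ⁅e, w⁆ = 0) (n : ℕ) :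
    (toEnd K L M e ^ n) ((toEnd K L M f ^ n) w) =
      (n.factorial : K) •
        aeval (toEnd K L M h) (∏ j ∈ Finset.range n, (X - C (j : K))) w := by
  induction n generalizing w with
  | zero => simp
  | succ n ih =>
    rw [pow_succ, End.mul_apply, toEnd_apply_apply,
      t.lie_e_pow_succ_toEnd_f_of_lie_e_eq_zero hw, map_smul, ih (t.lie_e_sub_smul_eq_zero hw _),
      Finset.prod_range_succ, map_mul, End.mul_apply, smul_smul, Nat.factorial_succ]
    simp [mul_comm, Nat.cast_smul_eq_nsmul]

lemma pow_toEnd_e_pow_toEnd_f_of_le [CharZero K] {t : IsSl2Triple h e f} {w : M} {m : ℕ}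
    (P : t.HasPrimitiveVectorWith w (m : K)) {n : ℕ} (hn : n ≤ m) :
    ∃ c : K, c ≠ 0 ∧ (toEnd K L M e ^ n) ((toEnd K L M f ^ n) w) = c • w := by
  induction n with
  | zero => exact ⟨1, one_ne_zero, by simp⟩
  | succ n ih =>
    obtain ⟨c, hc, hcw⟩ := ih (by lia)
    refine ⟨(n + 1) * (m - n) * c, ?_, ?_⟩
    · have : (m : K) - n ≠ 0 := sub_ne_zero.2 (by exact_mod_cast (by lia : m ≠ n))
      have : (n : K) + 1 ≠ 0 := Nat.cast_add_one_ne_zero n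
      positivity
    · rw [pow_succ, End.mul_apply, toEnd_apply_apply, P.lie_e_pow_succ_toEnd_f, map_smul, hcw,
        smul_smul]

lemma _root_.LieModule.mem_maxGenEigenspace_toEnd_neg_iff {x : L} {μ : K} {v : M} :
    v ∈ (toEnd K L M (-x)).maxGenEigenspace (-μ) ↔ v ∈ (toEnd K L M x).maxGenEigenspace μ := by
  have hneg : toEnd K L M (-x) - (-μ) • 1 = -(toEnd K L M x - μ • 1) := by
    rw [map_neg]
    module
  simp only [End.mem_maxGenEigenspace, hneg]
  refine exists_congr fun k ↦ ?_
  rcases neg_one_pow_eq_or (End K M) k with hk | hk <;> rw [neg_pow, hk] <;> simp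

variable [CharZero K] [FiniteDimensional K M]

lemma exists_pow_toEnd_f_eq_zero (t : IsSl2Triple h e f) {μ : K} {w : M}
    (hw : w ∈ (toEnd K L M h).maxGenEigenspace μ) :
    ∃ n : ℕ, (toEnd K L M f ^ n) w = 0 := by
  by_contra! contra
  have hinj : Function.Injective fun n : ℕ ↦ μ - 2 * (n : K) := fun a b hab ↦ by
    simpa using hab
  refine Set.infinite_range_of_injective hinj
    ((End.finite_hasEigenvalue (toEnd K L M h)).subset ?_)
  rintro _ ⟨n, rfl⟩
  by_contra hne
  have hbot : (toEnd K L M h).maxGenEigenspace (μ - 2 * n) = ⊥ := by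
    by_contra hbot
    exact hne (End.HasUnifEigenvalue.lt zero_lt_one hbot)
  have := t.pow_toEnd_f_mem_maxGenEigenspace hw n
  rw [hbot, Submodule.mem_bot] at this
  exact contra n this

lemma lie_h_eq_smul_of_lie_e_eq_zero (t : IsSl2Triple h e f) {μ : K} {w : M}
    (hw : w ∈ (toEnd K L M h).maxGenEigenspace μ) (hew : ⁅e, w⁆ = 0) :
    ⁅h, w⁆ = μ • w := by
  obtain ⟨n, hn⟩ := t.exists_pow_toEnd_f_eq_zero hw
  obtain ⟨k, hk⟩ := (End.mem_maxGenEigenspace _ _ _).1 hw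
  have hP : aeval (toEnd K L M h) (∏ j ∈ Finset.range n, (X - C (j : K))) w = 0 := by
    have := t.pow_toEnd_e_pow_toEnd_f (K := K) hew n
    rw [hn, map_zero, eq_comm, smul_eq_zero] at this
    exact this.resolve_left (by exact_mod_cast n.factorial_ne_zero)
  classical
  set Q : K[X] := ∏ j ∈ Finset.range n with ((j : ℕ) : K) ≠ μ, (X - C (j : K)) with hQ
  have hdvd : (∏ j ∈ Finset.range n, (X - C (j : K))) ∣ Q * (X - C μ) := by
    rw [← Finset.prod_filter_mul_prod_filter_not (Finset.range n) (fun j : ℕ ↦ (j : K) ≠ μ)]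
    refine mul_dvd_mul_left _ ?_
    rw [Finset.prod_congr rfl (g := fun _ ↦ X - C μ) (fun j hj ↦ by simp_all)]
    rw [Finset.prod_const]
    refine (pow_dvd_pow _ ?_).trans (pow_one _).dvd
    refine Finset.card_le_one.2 fun a ha b hb ↦ ?_
    have ha' : (a : K) = μ := by simpa using (Finset.mem_filter.1 ha).2
    have hb' : (b : K) = μ := by simpa using (Finset.mem_filter.1 hb).2
    exact_mod_cast ha'.trans hb'.symm
  have hcop : IsCoprime Q ((X - C μ) ^ k) := by
    refine IsCoprime.pow_right (IsCoprime.prod_left fun j hj ↦ ?_)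
    exact isCoprime_X_sub_C_of_isUnit_sub (sub_ne_zero.2 (Finset.mem_filter.1 hj).2).isUnit
  have hsub : aeval (toEnd K L M h) (X - C μ) w = ⁅h, w⁆ - μ • w := by
    simp [algebraMap_end_apply]
  obtain ⟨r, hr⟩ := hdvd
  have h1 : aeval (toEnd K L M h) Q (⁅h, w⁆ - μ • w) = 0 := by
    rw [← hsub, ← End.mul_apply, ← map_mul, hr, mul_comm, map_mul, End.mul_apply, hP, map_zero]
  have h2 : aeval (toEnd K L M h) ((X - C μ) ^ k) (⁅h, w⁆ - μ • w) = 0 := by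
    rw [← hsub, ← End.mul_apply, ← map_mul, mul_comm, map_mul, End.mul_apply]
    have : aeval (toEnd K L M h) ((X - C μ) ^ k) w = 0 := by
      simpa [Algebra.algebraMap_eq_smul_one] using hk
    rw [this, map_zero]
  obtain ⟨a, b, hab⟩ := hcop
  have h3 := congrArg (fun p ↦ aeval (toEnd K L M h) p (⁅h, w⁆ - μ • w)) hab
  simp only [map_add, map_mul, LinearMap.add_apply, End.mul_apply, h1, h2, map_zero, map_one,
    End.one_apply, add_zero] at h3
  exact sub_eq_zero.1 h3.symm

lemma lie_h_eq_smul_of_nat (t : IsSl2Triple h e f) {l : ℕ} {v : M}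
    (hv : v ∈ (toEnd K L M h).maxGenEigenspace (l : K)) : ⁅h, v⁆ = (l : K) • v := by
  obtain ⟨n, hn⟩ : ∃ n : ℕ, (toEnd K L M e ^ n) v = 0 := by
    refine t.symm.exists_pow_toEnd_f_eq_zero (μ := -(l : K)) ?_
    exact mem_maxGenEigenspace_toEnd_neg_iff.2 hv
  induction n generalizing v with
  | zero =>
    obtain rfl : v = 0 := by simpa using hn
    simp
  | succ n ih =>
    set w := (toEnd K L M e ^ n) v with hw
    have hew : ⁅e, w⁆ = 0 := by rwa [pow_succ', End.mul_apply] at hn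
    by_cases hw0 : w = 0
    · exact ih hv hw0
    have hmem : w ∈ (toEnd K L M h).maxGenEigenspace ((l + 2 * n : ℕ) : K) := by
      rw [← mem_maxGenEigenspace_toEnd_neg_iff]
      convert t.symm.pow_toEnd_f_mem_maxGenEigenspace
        (mem_maxGenEigenspace_toEnd_neg_iff.2 hv) n using 2
      push_cast
      ring
    have P : t.HasPrimitiveVectorWith w ((l + 2 * n : ℕ) : K) :=
      ⟨hw0, t.lie_h_eq_smul_of_lie_e_eq_zero hmem hew, hew⟩
    obtain ⟨c, hc, hcw⟩ := pow_toEnd_e_pow_toEnd_f_of_le P (n := n) (by lia)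
    have hu : ⁅h, (toEnd K L M f ^ n) w⁆ = (l : K) • (toEnd K L M f ^ n) w := by
      rw [P.lie_h_pow_toEnd_f]
      push_cast
      module
    have hu' : (toEnd K L M f ^ n) w ∈ (toEnd K L M h).maxGenEigenspace (l : K) :=
      (End.mem_maxGenEigenspace _ _ _).2 ⟨1, by simp [hu]⟩
    have := ih (v := v - c⁻¹ • (toEnd K L M f ^ n) w)
      (sub_mem hv (Submodule.smul_mem _ _ hu'))
      (by rw [map_sub, map_smul, hcw, smul_smul, inv_mul_cancel₀ hc, one_smul, sub_self])
    rw [lie_sub, lie_smul, hu, smul_sub, smul_comm] at this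
    simpa using this

lemma exists_int_of_hasEigenvalue (t : IsSl2Triple h e f) {μ : K}
    (hμ : (toEnd K L M h).HasEigenvalue μ) : ∃ k : ℤ, μ = k := by
  obtain ⟨v, hv⟩ := hμ.exists_hasEigenvector
  have hmem := mem_maxGenEigenspace_toEnd_neg_iff.2 (End.eigenspace_le_maxGenEigenspace hv.1)
  obtain ⟨n, hn, hn'⟩ := Nat.exists_not_and_succ_of_not_zero_of_exists
    (p := fun n ↦ (toEnd K L M e ^ n) v = 0) hv.2 (t.symm.exists_pow_toEnd_f_eq_zero hmem)
  have P : t.HasPrimitiveVectorWith ((toEnd K L M e ^ n) v) (μ + 2 * n) :=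
    ⟨hn, t.lie_h_pow_toEnd_e hv.apply_eq_smul n, by rwa [lie_e_pow_toEnd_e n]⟩
  obtain ⟨m, hm⟩ := P.exists_nat
  exact ⟨m - 2 * n, by push_cast; exact eq_sub_of_add_eq hm⟩

lemma maxGenEigenspace_eq_eigenspace (t : IsSl2Triple h e f) (μ : K) :
    (toEnd K L M h).maxGenEigenspace μ = (toEnd K L M h).eigenspace μ := by
  refine le_antisymm (fun v hv ↦ ?_) End.eigenspace_le_maxGenEigenspace
  by_cases hbot : (toEnd K L M h).maxGenEigenspace μ = ⊥
  · rw [hbot, Submodule.mem_bot] at hv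
    simp [hv]
  obtain ⟨k, rfl⟩ := t.exists_int_of_hasEigenvalue (End.HasUnifEigenvalue.lt zero_lt_one hbot)
  rw [End.mem_eigenspace_iff, toEnd_apply_apply]
  obtain ⟨l, rfl | rfl⟩ := k.eq_nat_or_neg
  · simpa using t.lie_h_eq_smul_of_nat (l := l) (by simpa using hv)
  · have := t.symm.lie_h_eq_smul_of_nat (K := K) (l := l) (v := v) (by
      rw [← mem_maxGenEigenspace_toEnd_neg_iff]
      simpa using hv)
    rw [neg_lie, neg_eq_iff_eq_neg] at this
    simpa using this

end IsSl2Triple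


/-- Let `(h, e, f)` be an sl2-triple in a finite-dimensional complex
semisimple Lie algebra `g`.  Then `ad h` is diagonalizable with integer eigenvalues:
`g` is the internal direct sum of the eigenspaces of `ad h` (the eigenspaces are
independent and span), and every eigenvalue of `ad h` is an integer. -/
theorem ad_h_diagonalizable_integer_eigenvalues
    {L : Type*} [LieRing L] [LieAlgebra ℂ L] [FiniteDimensional ℂ L]
    [LieAlgebra.IsSemisimple ℂ L]
    (h e f : L) (he : e ≠ 0)
    (hhe : ⁅h, e⁆ = (2 : ℂ) • e) (hhf : ⁅h, f⁆ = (-2 : ℂ) • f) (hef : ⁅e, f⁆ = h) :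
    iSupIndep (fun μ : ℂ => Module.End.eigenspace (LieAlgebra.ad ℂ L h) μ) ∧
    (⨆ μ : ℂ, Module.End.eigenspace (LieAlgebra.ad ℂ L h) μ) = ⊤ ∧
    (∀ μ : ℂ, Module.End.eigenspace (LieAlgebra.ad ℂ L h) μ ≠ ⊥ → ∃ k : ℤ, μ = (k : ℂ)) := by
  have t : IsSl2Triple h e f := by
    refine ⟨?_, hef, by rw [hhe, two_smul, two_smul], by rw [hhf, neg_smul, two_smul, two_smul]⟩
    rintro rfl
    exact he (by simpa using hhe.symm)
  refine ⟨Module.End.eigenspaces_iSupIndep _, ?_, fun μ hμ ↦ t.exists_int_of_hasEigenvalue hμ⟩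
  rw [← Module.End.iSup_maxGenEigenspace_eq_top (LieAlgebra.ad ℂ L h)]
  exact iSup_congr fun μ ↦ (t.maxGenEigenspace_eq_eigenspace μ).symm
end

section
/- Let g be a finite-dimensional complex semisimple Lie algebra and (h, e, f) an sl2-triple in g, and let V = ker(ad e) be the centralizer of e. Then V is invariant under ad h, V is the internal direct sum of the subspaces V_j = V ∩ g_j over all integers j ≥ 0, where g_j is the eigenspace of ad h with eigenvalue j, and V ∩ g_j = 0 for every integer j < 0. -/
/-- Over a field of characteristic zero, an eigenvector `f` of `ad h` with nonzero eigenvalue is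
nilpotent. -/
theorem Module.End.isNilpotent_of_commutator_eq_smul {K M : Type*} [Field K] [CharZero K]
    [AddCommGroup M] [Module K M] [FiniteDimensional K M] {h f : Module.End K M} {c : K}
    (hc : c ≠ 0) (hf : h * f - f * h = c • f) : IsNilpotent f := by
  by_contra! hne
  have hpow (n : ℕ) : h * f ^ n - f ^ n * h = (n * c) • f ^ n := by
    induction n with
    | zero => simp
    | succ n ih =>
      calc h * f ^ (n + 1) - f ^ (n + 1) * h
          = (h * f ^ n - f ^ n * h) * f + f ^ n * (h * f - f * h) := by
            rw [pow_succ]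
            noncomm_ring
        _ = _ := by
          rw [ih, hf, smul_mul_assoc, mul_smul_comm, ← pow_succ, ← add_smul]
          push_cast
          ring_nf
  have hinj : Function.Injective fun n : ℕ => (n : K) * c := fun a b hab => by
    simpa [hc] using hab
  have := (Module.End.eigenvectors_linearIndependent'
    (LinearMap.mulLeft K h - LinearMap.mulRight K h)
    (fun n : ℕ => (n : K) * c) hinj (fun n => f ^ n)
    (fun n => ⟨Module.End.mem_eigenspace_iff.mpr (hpow n), fun h0 => hne ⟨n, h0⟩⟩)).finite
  exact not_finite ℕ

/-- The commutator of `e` with a power of `f`, for elements satisfying the `sl₂` relations in an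
associative ring. -/
theorem mul_pow_succ_of_sl2_relations {A : Type*} [Ring A] {h e f : A}
    (hhf : h * f = f * h - 2 * f) (hef : e * f = f * e + h) (n : ℕ) :
    e * f ^ (n + 1) = f ^ (n + 1) * e + (n + 1) * (f ^ n * (h - n)) := by
  have hpow (n : ℕ) : h * f ^ n = f ^ n * (h - 2 * n) := by
    induction n with
    | zero => simp
    | succ n ih =>
      rw [pow_succ, ← mul_assoc, ih, mul_assoc, sub_mul, hhf, mul_assoc 2, Nat.cast_comm n f]
      push_cast
      noncomm_ring
  induction n with
  | zero => simpa using hef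
  | succ n ih =>
    have hc : f * (((n : A) + 1) * (f ^ n * (h - n))) = (n + 1) * (f ^ (n + 1) * (h - n)) := by
      rw [← Nat.cast_succ, ← mul_assoc, ← Nat.cast_comm, mul_assoc, ← mul_assoc f, ← pow_succ']
    rw [pow_succ' f (n + 1), ← mul_assoc, hef, add_mul, mul_assoc, ih, mul_add, hc, hpow,
      mul_assoc, add_assoc]
    congr 1
    have hn := Nat.cast_comm n (f ^ (n + 1))
    generalize f ^ (n + 1) = g at hn
    push_cast
    simp only [mul_sub, mul_add, add_mul, two_mul, mul_two, mul_one, one_mul, ← hn]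
    abel

open Polynomial in
/-- If `e x = 0`, then `eⁿ fⁿ x = n! h (h - 1) ⋯ (h - n + 1) x`. -/
theorem pow_mul_pow_apply_of_sl2_relations {K M : Type*} [Field K] [AddCommGroup M] [Module K M]
    {h e f : Module.End K M} (hhe : h * e = e * h + 2 * e) (hhf : h * f = f * h - 2 * f)
    (hef : e * f = f * e + h) (n : ℕ) {x : M} (hx : e x = 0) :
    (e ^ n) ((f ^ n) x) = (n.factorial : K) • aeval h (descPochhammer K n) x := by
  induction n generalizing x with
  | zero => simp
  | succ n ih =>
    have key := LinearMap.congr_fun (mul_pow_succ_of_sl2_relations hhf hef n) x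
    have hehx : e (h x) = 0 := by
      have := LinearMap.congr_fun hhe x
      simpa [hx, two_mul] using this.symm
    have hy : e ((h - n) x) = 0 := by
      simp [hx, hehx, LinearMap.sub_apply, Module.End.natCast_apply]
    have key' : e ((f ^ (n + 1)) x) = ((n : K) + 1) • (f ^ n) ((h - n) x) := by
      rw [← Module.End.mul_apply, key, ← Nat.cast_succ, ← Nat.cast_succ]
      simp only [LinearMap.add_apply, Module.End.mul_apply, hx, map_zero, zero_add,
        Module.End.natCast_apply, Nat.cast_smul_eq_nsmul]
    rw [pow_succ e, Module.End.mul_apply, key', map_smul, ih hy, descPochhammer_succ_right,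
      map_mul, Module.End.mul_apply, smul_smul, Nat.factorial_succ]
    simp

open Polynomial in
theorem aeval_apply_mem_of_mem_invtSubmodule {R M : Type*} [CommRing R] [AddCommGroup M]
    [Module R M] {h : Module.End R M} {V : Submodule R M} (hV : V ∈ h.invtSubmodule) (p : R[X])
    {x : M} (hx : x ∈ V) : aeval h p x ∈ V := by
  induction p using Polynomial.induction_on' with
  | add p q hp hq => simpa using add_mem hp hq
  | monomial n a =>
    rw [aeval_monomial, Module.End.mul_apply, Module.algebraMap_end_apply]
    refine V.smul_mem a ?_
    induction n with
    | zero => simpa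
    | succ n ih => simpa [pow_succ'] using hV ih

open Polynomial in
/-- A vector killed by `h (h - 1) ⋯ (h - n + 1)` and lying in an `h`-stable submodule `V` is a sum
of eigenvectors of `h` in `V` with natural number eigenvalues. -/
theorem mem_iSup_inf_eigenspace_of_aeval_descPochhammer {K M : Type*} [Field K] [CharZero K]
    [AddCommGroup M] [Module K M] {h : Module.End K M} {V : Submodule K M}
    (hV : V ∈ h.invtSubmodule) (n : ℕ) {x : M} (hx : x ∈ V)
    (hn : aeval h (descPochhammer K n) x = 0) :
    x ∈ ⨆ j : ℕ, V ⊓ h.eigenspace (j : K) := by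
  induction n generalizing x with
  | zero => simp_all
  | succ n ih =>
    set y := aeval h (descPochhammer K n) x with hy
    have hyV : y ∈ V := aeval_apply_mem_of_mem_invtSubmodule hV _ hx
    have hye : y ∈ h.eigenspace (n : K) := by
      rw [descPochhammer_succ_right, mul_comm, map_mul, Module.End.mul_apply, ← hy] at hn
      rw [Module.End.mem_eigenspace_iff, ← sub_eq_zero]
      simpa [Nat.cast_smul_eq_nsmul] using hn
    have hfac : (n.factorial : K) ≠ 0 := by exact_mod_cast n.factorial_ne_zero
    have hz : x - (n.factorial : K)⁻¹ • y ∈ ⨆ j : ℕ, V ⊓ h.eigenspace (j : K) := by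
      refine ih (V.sub_mem hx (V.smul_mem _ hyV)) ?_
      rw [map_sub, map_smul, ← hy, Module.End.aeval_apply_of_mem_apply_eq_smul (Module.End.mem_eigenspace_iff.mp hye),
        descPochhammer_eval_eq_descFactorial, Nat.descFactorial_self, smul_smul,
        inv_mul_cancel₀ hfac, one_smul, sub_self]
    rw [← sub_add_cancel x ((n.factorial : K)⁻¹ • y)]
    exact add_mem hz (Submodule.smul_mem _ _
      (Submodule.mem_iSup_of_mem n (Submodule.mem_inf.mpr ⟨hyV, hye⟩)))


/-- Let `(h, e, f)` be an sl2-triple in a finite-dimensional complex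
semisimple Lie algebra and `V = ker(ad e)`.  Then `V` is invariant under `ad h`, `V` is
the internal direct sum of the subspaces `V_j = V ∩ g_j` over integers `j ≥ 0`, and
`V ∩ g_j = 0` for every integer `j < 0`. -/
theorem centralizer_e_graded_nonneg
    {L : Type*} [LieRing L] [LieAlgebra ℂ L] [FiniteDimensional ℂ L]
    [LieAlgebra.IsSemisimple ℂ L]
    (h e f : L) (he : e ≠ 0)
    (hhe : ⁅h, e⁆ = (2 : ℂ) • e) (hhf : ⁅h, f⁆ = (-2 : ℂ) • f) (hef : ⁅e, f⁆ = h) :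
    (∀ x : L, ⁅e, x⁆ = 0 → ⁅e, ⁅h, x⁆⁆ = 0) ∧
    iSupIndep (fun j : ℕ => LinearMap.ker (LieAlgebra.ad ℂ L e) ⊓
      Module.End.eigenspace (LieAlgebra.ad ℂ L h) ((j : ℕ) : ℂ)) ∧
    (⨆ j : ℕ, LinearMap.ker (LieAlgebra.ad ℂ L e) ⊓
      Module.End.eigenspace (LieAlgebra.ad ℂ L h) ((j : ℕ) : ℂ)) =
        LinearMap.ker (LieAlgebra.ad ℂ L e) ∧
    (∀ k : ℤ, k < 0 → LinearMap.ker (LieAlgebra.ad ℂ L e) ⊓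
      Module.End.eigenspace (LieAlgebra.ad ℂ L h) ((k : ℤ) : ℂ) = ⊥) := by
  set H := LieAlgebra.ad ℂ L h with hH
  set E := LieAlgebra.ad ℂ L e with hE
  set F := LieAlgebra.ad ℂ L f with hF
  have rHE : H * E = E * H + 2 * E := by
    ext x
    simp [hH, hE, leibniz_lie h e x, hhe, two_mul, two_smul, add_comm]
  have rHF : H * F = F * H - 2 * F := by
    ext x
    simp [hH, hF, leibniz_lie h f x, hhf, two_mul, two_smul]
    rw [← lie_skew x f]
    module
  have rEF : E * F = F * E + H := by
    ext x
    simp [hH, hE, hF, leibniz_lie e f x, hef, add_comm]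
  have hinv : ∀ x : L, ⁅e, x⁆ = 0 → ⁅e, ⁅h, x⁆⁆ = 0 := fun x hx => by
    rw [leibniz_lie, ← lie_skew e h, hhe, hx]
    simp [hx]
  have hV : LinearMap.ker E ∈ H.invtSubmodule := fun x hx => hinv x hx
  obtain ⟨N, hN⟩ := Module.End.isNilpotent_of_commutator_eq_smul (by norm_num : (-2 : ℂ) ≠ 0)
    (show H * F - F * H = (-2 : ℂ) • F by rw [rHF, neg_smul, two_smul, two_mul]; abel)
  have hkill (x : L) (hx : E x = 0) : Polynomial.aeval H (descPochhammer ℂ N) x = 0 := by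
    have := pow_mul_pow_apply_of_sl2_relations rHE rHF rEF N hx
    rw [hN, LinearMap.zero_apply, map_zero, eq_comm, smul_eq_zero] at this
    exact this.resolve_left (by exact_mod_cast N.factorial_ne_zero)
  refine ⟨hinv, ?_, le_antisymm (iSup_le fun j => inf_le_left) fun x hx =>
    mem_iSup_inf_eigenspace_of_aeval_descPochhammer hV N hx (hkill x hx), fun k hk => ?_⟩
  · exact (H.eigenspaces_iSupIndep.comp (Nat.cast_injective (R := ℂ))).mono fun _ => inf_le_right
  · refine (Submodule.eq_bot_iff _).mpr fun x ⟨hx, hxk⟩ => ?_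
    have := hkill x hx
    rw [Module.End.aeval_apply_of_mem_apply_eq_smul (Module.End.mem_eigenspace_iff.mp hxk),
      smul_eq_zero,
      descPochhammer_eval_eq_prod_range, Finset.prod_eq_zero_iff] at this
    refine this.resolve_left fun ⟨j, _, hj⟩ => ?_
    have : k - j = 0 := by exact_mod_cast hj
    omega
end

section
/- Let g be a finite-dimensional complex semisimple Lie algebra and (h, e, f) an sl2-triple in g. Then g is the internal direct sum of ker(ad e) and the image of ad f: g = ker(ad e) ⊕ [f, g], where [f, g] = {[f, x] : x ∈ g}. In particular the Slodowy slice f + ker(ad e) is transverse to the tangent space [g, f] of the adjoint orbit through f, in the sense that ker(ad e) + [g, f] = g and ker(ad e) ∩ [g, f] = 0. -/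
namespace IsSl2Triple

open LieModule Module Polynomial

section CommRing

variable {R L M : Type*} [CommRing R] [LieRing L] [LieAlgebra R L]
  [AddCommGroup M] [Module R M] [LieRingModule L M] [LieModule R L M] {h e f : L}

lemma lie_f_pow_succ_toEnd_e_s8 (t : IsSl2Triple h e f) (k : ℕ) (x : M) :
    ⁅f, (toEnd R L M e ^ (k + 1)) x⁆ =
      (toEnd R L M e ^ (k + 1)) ⁅f, x⁆ -
        ((k : R) + 1) • (toEnd R L M e ^ k) (⁅h, x⁆ + (k : R) • x) := by
  have hfe (y : M) : ⁅f, ⁅e, y⁆⁆ = ⁅e, ⁅f, y⁆⁆ - ⁅h, y⁆ := by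
    rw [← t.lie_e_f, lie_lie]; abel
  induction k generalizing x with
  | zero => simp [hfe]
  | succ k ih =>
    have hhe : ⁅h, ⁅e, x⁆⁆ = ⁅e, ⁅h, x⁆⁆ + (2 : R) • ⁅e, x⁆ := by
      rw [leibniz_lie, t.lie_h_e_smul R, smul_lie, add_comm]
    have hpow (j : ℕ) (y : M) :
        (toEnd R L M e ^ (j + 1)) y = (toEnd R L M e ^ j) ⁅e, y⁆ := by
      rw [pow_succ]; rfl
    rw [hpow, ih, hfe, hhe, hpow (k + 1) ⁅f, x⁆, hpow k (_ + _)]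
    simp only [map_sub, map_add, map_smul, lie_add, lie_smul, ← hpow]
    push_cast
    module

/-- A vector annihilated by `e f` is a sum of eigenvectors of `h` whose eigenvalues are
nonpositive integers. -/
lemma aeval_prod_eq_zero_of_lie_e_lie_f_eq_zero [IsDomain R] [CharZero R] [IsTorsionFree R M]
    (t : IsSl2Triple h e f) {n : ℕ} {x : M} (hx : ⁅e, ⁅f, x⁆⁆ = 0)
    (hn : (toEnd R L M e ^ n) x = 0) :
    aeval (toEnd R L M h) (∏ k ∈ Finset.range n, (X + C (k : R))) x = 0 := by
  induction n generalizing x with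
  | zero => simpa using hn
  | succ n ih =>
    have hk := t.lie_f_pow_succ_toEnd_e_s8 (R := R) n x
    rw [hn, lie_zero, pow_succ, Module.End.mul_apply, toEnd_apply_apply, hx, map_zero, zero_sub,
      eq_comm, neg_eq_zero, smul_eq_zero_iff_right (Nat.cast_add_one_ne_zero n)] at hk
    have hef : ⁅e, ⁅f, ⁅h, x⁆⁆⁆ = 0 := by
      have h₁ : ⁅f, ⁅h, x⁆⁆ = ⁅h, ⁅f, x⁆⁆ + (2 : R) • ⁅f, x⁆ := by
        rw [leibniz_lie h, t.lie_lie_smul_f R, neg_lie, smul_lie]; abel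
      have h₂ : ⁅e, ⁅h, ⁅f, x⁆⁆⁆ = ⁅h, ⁅e, ⁅f, x⁆⁆⁆ - (2 : R) • ⁅e, ⁅f, x⁆⁆ := by
        rw [leibniz_lie h e, t.lie_h_e_smul R, smul_lie]; abel
      simp [h₁, h₂, hx]
    have := ih (x := ⁅h, x⁆ + (n : R) • x) (by simp [hef, hx]) hk
    rw [Finset.prod_range_succ, map_mul, Module.End.mul_apply]
    simpa [Nat.cast_smul_eq_nsmul] using this

end CommRing

variable {K L M : Type*} [Field K] [CharZero K] [LieRing L] [LieAlgebra K L]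
  [AddCommGroup M] [Module K M] [LieRingModule L M] [LieModule K L M] [FiniteDimensional K M]
  {h e f : L}

attribute [local instance] LieRing.ofAssociativeRing in
lemma isNilpotent_toEnd_e (t : IsSl2Triple h e f) : IsNilpotent (toEnd K L M e) := by
  by_contra! contra
  have hne (n : ℕ) : toEnd K L M e ^ n ≠ 0 := fun h0 ↦ contra ⟨n, h0⟩
  have hcomm (n : ℕ) : ⁅toEnd K L M h, toEnd K L M e ^ n⁆ = (2 * n : K) • toEnd K L M e ^ n := by
    induction n with
    | zero => simp [Ring.lie_def]
    | succ n ih =>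
      have h₁ : ⁅toEnd K L M h, toEnd K L M e⁆ = (2 : K) • toEnd K L M e := by
        rw [← LieHom.map_lie, t.lie_h_e_smul K, map_smul]
      have h₂ : ⁅toEnd K L M h, toEnd K L M e ^ (n + 1)⁆ =
          ⁅toEnd K L M h, toEnd K L M e ^ n⁆ * toEnd K L M e +
            toEnd K L M e ^ n * ⁅toEnd K L M h, toEnd K L M e⁆ := by
        simp only [Ring.lie_def, pow_succ]; noncomm_ring
      rw [h₂, ih, h₁, smul_mul_assoc, mul_smul_comm, ← pow_succ, ← add_smul]
      push_cast; ring_nf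
  have hinj : Function.Injective fun n : ℕ ↦ (2 * n : K) := fun a b hab ↦ by simpa using hab
  have hli := Module.End.eigenvectors_linearIndependent'
    (LieAlgebra.ad K (Module.End K M) (toEnd K L M h)) (fun n : ℕ ↦ (2 * n : K)) hinj
    (fun n ↦ toEnd K L M e ^ n)
    (fun n ↦ Module.End.hasEigenvector_iff.mpr
      ⟨Module.End.mem_eigenspace_iff.mpr (hcomm n), hne n⟩)
  exact not_finite_iff_infinite.mpr inferInstance hli.finite

lemma disjoint_ker_toEnd_e_range_toEnd_f (t : IsSl2Triple h e f) :
    Disjoint (LinearMap.ker (toEnd K L M e)) (LinearMap.range (toEnd K L M f)) := by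
  rw [Submodule.disjoint_def]
  rintro _ hv ⟨w, rfl⟩
  replace hv : ⁅e, ⁅f, w⁆⁆ = 0 := hv
  obtain ⟨n, hn⟩ := t.isNilpotent_toEnd_e (K := K) (M := M)
  obtain ⟨m, hm⟩ := t.symm.isNilpotent_toEnd_e (K := K) (M := M)
  have hw := t.aeval_prod_eq_zero_of_lie_e_lie_f_eq_zero (R := K) hv (by rw [hn]; rfl)
  have hv' := t.symm.aeval_prod_eq_zero_of_lie_e_lie_f_eq_zero (R := K) (x := ⁅f, w⁆)
    (by rw [hv, lie_zero]) (by rw [hm]; rfl)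
  have hshift (p : K[X]) (x : M) :
      aeval (toEnd K L M h) (p.comp (X + C 2)) ⁅f, x⁆ = ⁅f, aeval (toEnd K L M h) p x⁆ := by
    have hcomm (y : M) : ⁅h, ⁅f, y⁆⁆ + (2 : K) • ⁅f, y⁆ = ⁅f, ⁅h, y⁆⁆ := by
      rw [leibniz_lie h, t.lie_lie_smul_f K, neg_lie, smul_lie]; abel
    induction p using Polynomial.induction_on' generalizing x with
    | add p q hp hq => simp [hp, hq]
    | monomial n a =>
      induction n generalizing x with
      | zero => simp
      | succ n ih =>
        rw [← monomial_mul_X, mul_comp, map_mul, map_mul, Module.End.mul_apply,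
          Module.End.mul_apply, aeval_X, toEnd_apply_apply, ← ih, ← hcomm]
        simp
  have hneg (p : K[X]) :
      aeval (toEnd K L M h) (p.comp (-X)) = aeval (toEnd K L M (-h)) p := by
    rw [aeval_comp]; simp
  refine Submodule.disjoint_def.mp (disjoint_ker_aeval_of_isCoprime (toEnd K L M h)
    (p := (∏ k ∈ Finset.range n, (X + C (k : K))).comp (X + C 2))
    (q := (∏ k ∈ Finset.range m, (X + C (k : K))).comp (-X)) ?_) _ ?_ ?_
  · rw [prod_comp, prod_comp]
    refine IsCoprime.prod_left fun i _ ↦ IsCoprime.prod_right fun j _ ↦ ?_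
    have hij : (i + 2 + j : K) ≠ 0 := by exact_mod_cast (by lia : i + 2 + j ≠ 0)
    refine ⟨C (i + 2 + j : K)⁻¹, C (i + 2 + j : K)⁻¹, ?_⟩
    rw [← mul_add]
    have : (X + C (i : K)).comp (X + C 2) + (X + C (j : K)).comp (-X) = C (i + 2 + j : K) := by
      simp only [add_comp, X_comp, C_comp, map_add]; ring
    rw [this, ← C_mul, inv_mul_cancel₀ hij, C_1]
  · rw [LinearMap.mem_ker, toEnd_apply_apply, hshift, hw, lie_zero]
  · rw [LinearMap.mem_ker, hneg]; exact hv'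

/-- In a finite-dimensional representation of `sl₂`, the kernel of `e` is a complement of the
range of `f`. -/
theorem isCompl_ker_toEnd_e_range_toEnd_f (t : IsSl2Triple h e f) :
    IsCompl (LinearMap.ker (toEnd K L M e)) (LinearMap.range (toEnd K L M f)) := by
  have hef := t.disjoint_ker_toEnd_e_range_toEnd_f (K := K) (M := M)
  have hfe := t.symm.disjoint_ker_toEnd_e_range_toEnd_f (K := K) (M := M)
  refine ⟨hef, codisjoint_iff.mpr (Submodule.eq_top_of_disjoint _ _ ?_ hef)⟩
  have h₁ := Submodule.finrank_add_finrank_le_of_disjoint hfe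
  have h₂ := (toEnd K L M e).finrank_range_add_finrank_ker
  have h₃ := (toEnd K L M f).finrank_range_add_finrank_ker
  lia

end IsSl2Triple

/-- Let `(h, e, f)` be an sl2-triple in a finite-dimensional complex
semisimple Lie algebra `g`.  Then `g = ker(ad e) ⊕ [f, g]`, where `[f, g]` is the image of
`ad f`.  In particular the Slodowy slice `f + ker(ad e)` is transverse to `[g, f]`:
`ker(ad e) + [g, f] = g` and `ker(ad e) ∩ [g, f] = 0`. -/
theorem ker_ad_e_sup_range_ad_f
    {L : Type*} [LieRing L] [LieAlgebra ℂ L] [FiniteDimensional ℂ L]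
    [LieAlgebra.IsSemisimple ℂ L]
    (h e f : L) (he : e ≠ 0)
    (hhe : ⁅h, e⁆ = (2 : ℂ) • e) (hhf : ⁅h, f⁆ = (-2 : ℂ) • f) (hef : ⁅e, f⁆ = h) :
    (LinearMap.ker (LieAlgebra.ad ℂ L e) ⊔ LinearMap.range (LieAlgebra.ad ℂ L f) = ⊤) ∧
    (LinearMap.ker (LieAlgebra.ad ℂ L e) ⊓ LinearMap.range (LieAlgebra.ad ℂ L f) = ⊥) ∧
    (∀ x : L, ∃ v w : L, ⁅e, v⁆ = 0 ∧ x = v + ⁅w, f⁆) ∧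
    (∀ v w : L, ⁅e, v⁆ = 0 → v = ⁅w, f⁆ → v = 0) := by

  have t : IsSl2Triple h e f :=
    { h_ne_zero := by
        rintro rfl
        rw [zero_lie, eq_comm] at hhe
        simp [he] at hhe
      lie_e_f := hef
      lie_h_e_nsmul := by rw [hhe, two_smul, two_nsmul]
      lie_h_f_nsmul := by rw [hhf, neg_smul, two_smul, two_nsmul] }
  have hc := t.isCompl_ker_toEnd_e_range_toEnd_f (K := ℂ) (M := L)
  refine ⟨hc.sup_eq_top, hc.inf_eq_bot, fun x ↦ ?_, fun v w hv hvw ↦ ?_⟩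
  · obtain ⟨v, hv, _, ⟨w, rfl⟩, hx⟩ :=
      Submodule.mem_sup.mp (hc.sup_eq_top ▸ Submodule.mem_top : x ∈ _)
    exact ⟨v, -w, hv, by rw [neg_lie, lie_skew]; exact hx.symm⟩
  · refine Submodule.disjoint_def.mp hc.disjoint v hv ⟨-w, ?_⟩
    rw [hvw, LieModule.toEnd_apply_apply, lie_neg, lie_skew]
end

section
/- Let g be a finite-dimensional complex semisimple Lie algebra and (h, e, f) an even sl2-triple in g, i.e. the eigenspace of ad h with eigenvalue k is zero for every odd integer k. Let p = ⨁_{j ≥ 0} g_j be the sum of the eigenspaces of ad h with nonnegative eigenvalues and u = ⨁_{j > 0} g_j the sum of the eigenspaces with positive eigenvalues. Then p is the internal direct sum of ker(ad e) and [f, u] = {[f, x] : x ∈ u}: p = ker(ad e) ⊕ [f, u]. -/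
open Module Polynomial

section

variable {V : Type*} [AddCommGroup V] [Module ℂ V] {H A B : End ℂ V}

theorem Module.End.mul_sub_mul_pow_of_weight {c : ℂ} (hA : H * A - A * H = c • A) (n : ℕ) :
    H * A ^ n - A ^ n * H = (n * c) • A ^ n := by
  induction n with
  | zero => simp
  | succ n ih =>
    calc H * A ^ (n + 1) - A ^ (n + 1) * H
        = (H * A ^ n - A ^ n * H) * A + A ^ n * (H * A - A * H) := by rw [pow_succ]; noncomm_ring
      _ = _ := by
        rw [ih, hA, smul_mul_assoc, mul_smul_comm, ← pow_succ, ← add_smul]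
        push_cast
        ring_nf

/-- A weight vector of nonzero weight under commutation with an operator is nilpotent. -/
theorem Module.End.isNilpotent_of_weight [FiniteDimensional ℂ V] {c : ℂ} (hc : c ≠ 0)
    (hA : H * A - A * H = c • A) : IsNilpotent A := by
  by_contra hn
  let D : End ℂ (End ℂ V) := LinearMap.mulLeft ℂ H - LinearMap.mulRight ℂ H
  have hD (n : ℕ) : D.HasEigenvalue (n * c) :=
    End.hasEigenvalue_of_hasEigenvector (x := A ^ n)
      ⟨End.mem_eigenspace_iff.2 (by simpa [D] using End.mul_sub_mul_pow_of_weight hA n),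
        fun h0 => hn ⟨n, h0⟩⟩
  refine Set.infinite_univ (α := ℕ) (Set.Finite.of_finite_image (f := fun n : ℕ => (n * c : ℂ))
    (D.finite_hasEigenvalue.subset ?_) fun a _ b _ hab => ?_)
  · rintro _ ⟨n, -, rfl⟩
    exact hD n
  · exact Nat.cast_injective (mul_right_cancel₀ hc hab)

theorem Module.End.apply_mem_eigenspace_of_weight {c μ ν : ℂ} (hA : H * A - A * H = c • A)
    (hν : ν = μ + c) {v : V} (hv : v ∈ H.eigenspace μ) : A v ∈ H.eigenspace ν := by
  rw [End.mem_eigenspace_iff] at hv ⊢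
  have := congrArg (· v) hA
  simp only [LinearMap.sub_apply, End.mul_apply, LinearMap.smul_apply, hv, map_smul] at this
  rw [sub_eq_iff_eq_add.1 this, ← add_smul, hν, add_comm]

theorem Module.End.mul_pow_succ_of_sl2 (hB : H * B - B * H = (-2 : ℂ) • B)
    (hAB : A * B - B * A = H) (n : ℕ) :
    A * B ^ (n + 1) = B ^ (n + 1) * A + ((n : ℂ) + 1) • (B ^ n * (H - (n : ℂ) • 1)) := by
  induction n with
  | zero => simp [← hAB]
  | succ n ih =>
    have h1 : A * B = B * A + H := by rw [← hAB]; abel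
    have h2 : H * B = B * H + (-2 : ℂ) • B := by rw [← hB]; abel
    rw [pow_succ, ← mul_assoc, ih, add_mul, mul_assoc, h1, smul_mul_assoc, mul_assoc, sub_mul, h2]
    simp only [mul_add, mul_sub, smul_mul_assoc, mul_smul_comm, one_mul, mul_one, pow_succ,
      mul_assoc]
    push_cast
    module

/-- On the kernel of the raising operator, `Aⁿ Bⁿ` is a polynomial in the weight operator. -/
theorem Module.End.pow_pow_apply_of_sl2 (hA : H * A - A * H = (2 : ℂ) • A)
    (hB : H * B - B * H = (-2 : ℂ) • B) (hAB : A * B - B * A = H) (n : ℕ) {v : V}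
    (hv : A v = 0) :
    (A ^ n) ((B ^ n) v) =
      (n.factorial : ℂ) • aeval H (∏ k ∈ Finset.range n, (X - C (k : ℂ))) v := by
  induction n generalizing v with
  | zero => simp
  | succ n ih =>
    have hw : A ((H - (n : ℂ) • 1) v) = 0 := by
      have := congrArg (· v) hA
      simp only [LinearMap.sub_apply, End.mul_apply, LinearMap.smul_apply, hv, map_zero, zero_sub,
        smul_zero, neg_eq_zero] at this
      simp [hv, this]
    have h1 := congrArg (· v) (End.mul_pow_succ_of_sl2 hB hAB n)
    simp only [End.mul_apply, LinearMap.add_apply, LinearMap.smul_apply, hv, map_zero,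
      zero_add] at h1
    rw [pow_succ, End.mul_apply, h1, map_smul, ih hw, smul_smul, Finset.prod_range_succ, map_mul,
      End.mul_apply, Nat.factorial_succ]
    have h2 : aeval H (X - C (n : ℂ)) v = (H - (n : ℂ) • 1) v := by
      simp [Nat.cast_smul_eq_nsmul]
    rw [h2]
    push_cast
    rfl

theorem Module.End.ker_aeval_prod_le_iSup_eigenspace (N : ℕ) :
    LinearMap.ker (aeval H (∏ k ∈ Finset.range N, (X - C (k : ℂ)))) ≤
      ⨆ (j : ℤ) (_ : 0 ≤ j), H.eigenspace (j : ℂ) := by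
  induction N with
  | zero => simp [End.one_eq_id]
  | succ N ih =>
    have hco : IsCoprime (∏ k ∈ Finset.range N, (X - C (k : ℂ))) (X - C (N : ℂ)) := by
      refine IsCoprime.prod_left fun k hk => isCoprime_X_sub_C_of_isUnit_sub ?_
      rw [isUnit_iff_ne_zero, sub_ne_zero]
      exact_mod_cast (Finset.mem_range.1 hk).ne
    rw [Finset.prod_range_succ, ← sup_ker_aeval_eq_ker_aeval_mul_of_coprime H hco]
    refine sup_le ih (le_trans ?_ (le_iSup₂_of_le (N : ℤ) (by positivity) le_rfl))
    intro v hv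
    rw [End.mem_eigenspace_iff]
    simpa [sub_eq_zero, Nat.cast_smul_eq_nsmul] using hv

variable [FiniteDimensional ℂ V]

theorem Module.End.ker_le_iSup_eigenspace_of_sl2 (hA : H * A - A * H = (2 : ℂ) • A)
    (hB : H * B - B * H = (-2 : ℂ) • B) (hAB : A * B - B * A = H) :
    LinearMap.ker A ≤ ⨆ (j : ℤ) (_ : 0 ≤ j), H.eigenspace (j : ℂ) := by
  obtain ⟨N, hN⟩ := End.isNilpotent_of_weight (by norm_num) hB
  refine le_trans (fun v hv => ?_) (End.ker_aeval_prod_le_iSup_eigenspace N)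
  have := End.pow_pow_apply_of_sl2 hA hB hAB N (LinearMap.mem_ker.1 hv)
  rw [hN, LinearMap.zero_apply, map_zero, eq_comm, smul_eq_zero] at this
  exact this.resolve_left (Nat.cast_ne_zero.2 N.factorial_ne_zero)

/-- On a positive weight space, `A * B` has no nonpositive integral eigenvalue. -/
theorem Module.End.eq_zero_of_mul_apply_eq_smul_of_sl2 (hA : H * A - A * H = (2 : ℂ) • A)
    (hAB : A * B - B * A = H) {k c : ℤ} (hk : 0 < k) (hc : c ≤ 0) {v : V}
    (hv : v ∈ H.eigenspace (k : ℂ)) (hvc : A (B v) = (c : ℂ) • v) : v = 0 := by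
  obtain ⟨N, hN⟩ := End.isNilpotent_of_weight (by norm_num) hA
  have hNv : (A ^ N) v = 0 := by simp [hN]
  clear hN
  induction N generalizing k c v with
  | zero => simpa using hNv
  | succ N ih =>
    have hBA : B (A v) = ((c - k : ℤ) : ℂ) • v := by
      have := congrArg (· v) hAB
      simp only [LinearMap.sub_apply, End.mul_apply, hvc, End.mem_eigenspace_iff.1 hv] at this
      rw [← sub_sub_self ((c : ℂ) • v) (B (A v)), this, ← sub_smul, Int.cast_sub]
    have hAv : A v = 0 := by
      refine ih (k := k + 2) (c := c - k) (by lia) (by lia)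
        (End.apply_mem_eigenspace_of_weight hA (by push_cast; rfl) hv) ?_ ?_
      · rw [hBA, map_smul]
      · rw [← hNv, pow_succ, End.mul_apply]
    rw [hAv, map_zero, eq_comm, smul_eq_zero] at hBA
    exact hBA.resolve_left (by exact_mod_cast (by lia : c - k ≠ 0))

theorem Module.End.exists_mem_eigenspace_apply_apply_eq_of_sl2
    (hA : H * A - A * H = (2 : ℂ) • A) (hB : H * B - B * H = (-2 : ℂ) • B)
    (hAB : A * B - B * A = H) {k : ℤ} (hk : 0 < k) {w : V} (hw : w ∈ H.eigenspace (k : ℂ)) :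
    ∃ v ∈ H.eigenspace (k : ℂ), A (B v) = w := by
  have hmaps : ∀ v ∈ H.eigenspace (k : ℂ), (A * B) v ∈ H.eigenspace (k : ℂ) := fun v hv =>
    End.apply_mem_eigenspace_of_weight (μ := k - 2) hA (by ring)
      (End.apply_mem_eigenspace_of_weight hB (by ring) hv)
  have hinj : Function.Injective ((A * B).restrict hmaps) := by
    rw [← LinearMap.ker_eq_bot, LinearMap.ker_eq_bot']
    rintro ⟨v, hv⟩ h0
    have h0' : A (B v) = 0 := congrArg Subtype.val h0
    exact Subtype.ext (End.eq_zero_of_mul_apply_eq_smul_of_sl2 hA hAB hk le_rfl hv (by simpa))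
  obtain ⟨⟨v, hv⟩, h⟩ := LinearMap.injective_iff_surjective.1 hinj ⟨w, hw⟩
  exact ⟨v, hv, congrArg Subtype.val h⟩

theorem Module.End.ker_sup_map_eq_of_sl2 (hA : H * A - A * H = (2 : ℂ) • A)
    (hB : H * B - B * H = (-2 : ℂ) • B) (hAB : A * B - B * A = H)
    (h1 : H.eigenspace 1 = ⊥) :
    LinearMap.ker A ⊔ (⨆ (j : ℤ) (_ : 0 < j), H.eigenspace (j : ℂ)).map B =
      ⨆ (j : ℤ) (_ : 0 ≤ j), H.eigenspace (j : ℂ) := by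
  refine le_antisymm (sup_le (End.ker_le_iSup_eigenspace_of_sl2 hA hB hAB) ?_) ?_
  · rw [Submodule.map_le_iff_le_comap]
    refine iSup₂_le fun j hj v hv => ?_
    obtain rfl | hj2 : j = 1 ∨ 2 ≤ j := by lia
    · rw [Int.cast_one, h1, Submodule.mem_bot] at hv
      simp [hv]
    · exact Submodule.mem_iSup_of_mem (j - 2) (Submodule.mem_iSup_of_mem (by lia)
        (End.apply_mem_eigenspace_of_weight hB (by push_cast; ring) hv))
  · refine iSup₂_le fun j hj x hx => ?_
    obtain ⟨v, hv, hvx⟩ := End.exists_mem_eigenspace_apply_apply_eq_of_sl2 hA hB hAB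
      (k := j + 2) (by lia) (End.apply_mem_eigenspace_of_weight hA (by push_cast; rfl) hx)
    rw [← sub_add_cancel x (B v)]
    refine Submodule.add_mem_sup (by simp [hvx]) (Submodule.mem_map_of_mem ?_)
    exact Submodule.mem_iSup_of_mem (j + 2) (Submodule.mem_iSup_of_mem (by lia) hv)

theorem Module.End.ker_inf_map_eq_bot_of_sl2 (hA : H * A - A * H = (2 : ℂ) • A)
    (hB : H * B - B * H = (-2 : ℂ) • B) (hAB : A * B - B * A = H) :
    LinearMap.ker A ⊓ (⨆ (j : ℤ) (_ : 0 < j), H.eigenspace (j : ℂ)).map B = ⊥ := by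
  set u := ⨆ (j : ℤ) (_ : 0 < j), H.eigenspace (j : ℂ) with hu
  have hmaps : ∀ v ∈ u, (A * B) v ∈ u := by
    change u ≤ u.comap (A * B)
    refine iSup₂_le fun j hj v hv => ?_
    exact Submodule.mem_iSup_of_mem j (Submodule.mem_iSup_of_mem hj
      (End.apply_mem_eigenspace_of_weight (μ := j - 2) hA (by ring)
        (End.apply_mem_eigenspace_of_weight hB (by ring) hv)))
  have hle : u ≤ u.map (A * B) := by
    refine iSup₂_le fun j hj w hw => ?_
    obtain ⟨v, hv, rfl⟩ := End.exists_mem_eigenspace_apply_apply_eq_of_sl2 hA hB hAB hj hw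
    exact ⟨v, Submodule.mem_iSup_of_mem j (Submodule.mem_iSup_of_mem hj hv), rfl⟩
  have hsurj : Function.Surjective ((A * B).restrict hmaps) := by
    rintro ⟨w, hw⟩
    obtain ⟨v, hv, h⟩ := hle hw
    exact ⟨⟨v, hv⟩, Subtype.ext h⟩
  have hinj := LinearMap.injective_iff_surjective.2 hsurj
  rw [Submodule.eq_bot_iff]
  rintro _ ⟨hx, v, hv, rfl⟩
  have : (⟨v, hv⟩ : u) = 0 := hinj (Subtype.ext (by simpa using hx))
  have hv0 : v = 0 := congrArg Subtype.val this
  rw [hv0, map_zero]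

end


/-- Let `(h, e, f)` be an even sl2-triple in a finite-dimensional complex
semisimple Lie algebra, `p = ⨁_{j ≥ 0} g_j` and `u = ⨁_{j > 0} g_j` (sums of `ad h`
eigenspaces).  Then `p = ker(ad e) ⊕ [f, u]`. -/
theorem parabolic_eq_ker_ad_e_oplus_ad_f_u
    {L : Type*} [LieRing L] [LieAlgebra ℂ L] [FiniteDimensional ℂ L]
    [LieAlgebra.IsSemisimple ℂ L]
    (h e f : L) (he : e ≠ 0)
    (hhe : ⁅h, e⁆ = (2 : ℂ) • e) (hhf : ⁅h, f⁆ = (-2 : ℂ) • f) (hef : ⁅e, f⁆ = h)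
    (heven : ∀ k : ℤ, Odd k →
      Module.End.eigenspace (LieAlgebra.ad ℂ L h) ((k : ℤ) : ℂ) = ⊥)
    (p u : Submodule ℂ L)
    (hp : p = ⨆ (j : ℤ) (_ : 0 ≤ j),
      Module.End.eigenspace (LieAlgebra.ad ℂ L h) ((j : ℤ) : ℂ))
    (hu : u = ⨆ (j : ℤ) (_ : 0 < j),
      Module.End.eigenspace (LieAlgebra.ad ℂ L h) ((j : ℤ) : ℂ)) :
    LinearMap.ker (LieAlgebra.ad ℂ L e) ⊔ Submodule.map (LieAlgebra.ad ℂ L f) u = p ∧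
    LinearMap.ker (LieAlgebra.ad ℂ L e) ⊓ Submodule.map (LieAlgebra.ad ℂ L f) u = ⊥ := by
  have had (x y z : L) (c : ℂ) (hxy : ⁅x, y⁆ = c • z) : LieAlgebra.ad ℂ L x * LieAlgebra.ad ℂ L y -
      LieAlgebra.ad ℂ L y * LieAlgebra.ad ℂ L x = c • LieAlgebra.ad ℂ L z := by
    ext w
    simp [← lie_lie, hxy]
  have hA := had h e e 2 hhe
  have hB := had h f f (-2) hhf
  have hAB := had e f h 1 (by rw [hef, one_smul])
  rw [one_smul] at hAB
  subst hp hu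
  exact ⟨Module.End.ker_sup_map_eq_of_sl2 hA hB hAB (by simpa using heven 1 odd_one),
    Module.End.ker_inf_map_eq_bot_of_sl2 hA hB hAB⟩
end

section
/- Let g be a finite-dimensional complex semisimple Lie algebra and (h, e, f) an sl2-triple in g. Then {x ∈ g : [x, e] = 0 and [x, h] = 0} = {x ∈ g : [x, e] = 0, [x, h] = 0 and [x, f] = 0}; that is, any element of g centralizing both e and h automatically centralizes f, so the weight-zero part of the centralizer of e equals the centralizer c of the whole sl2-subalgebra spanned by e, h, f. (This is the infinitesimal form of the Kostant–Malcev statement that the L-stabilizer of e is the centralizer C of the sl2-subalgebra.) -/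
/-- Let `(h, e, f)` be an sl2-triple in a finite-dimensional complex
semisimple Lie algebra `g`.  Then any element of `g` centralizing both `e` and `h`
automatically centralizes `f`:
`{x : ⁅x,e⁆ = 0 ∧ ⁅x,h⁆ = 0} = {x : ⁅x,e⁆ = 0 ∧ ⁅x,h⁆ = 0 ∧ ⁅x,f⁆ = 0}`. -/
theorem centralizer_e_h_eq_centralizer_triple
    {L : Type*} [LieRing L] [LieAlgebra ℂ L] [FiniteDimensional ℂ L]
    [LieAlgebra.IsSemisimple ℂ L]
    (h e f : L) (he : e ≠ 0)
    (hhe : ⁅h, e⁆ = (2 : ℂ) • e) (hhf : ⁅h, f⁆ = (-2 : ℂ) • f) (hef : ⁅e, f⁆ = h) :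
    {x : L | ⁅x, e⁆ = 0 ∧ ⁅x, h⁆ = 0} =
      {x : L | ⁅x, e⁆ = 0 ∧ ⁅x, h⁆ = 0 ∧ ⁅x, f⁆ = 0} := by
  have t : IsSl2Triple h e f :=
    { h_ne_zero := by
        rintro rfl
        exact he (by simpa using hhe.symm)
      lie_e_f := hef
      lie_h_e_nsmul := by rw [hhe, ofNat_smul_eq_nsmul]
      lie_h_f_nsmul := by rw [hhf, neg_smul, ofNat_smul_eq_nsmul] }
  ext x
  refine ⟨fun ⟨hxe, hxh⟩ ↦ ⟨hxe, hxh, ?_⟩, fun ⟨hxe, hxh, _⟩ ↦ ⟨hxe, hxh⟩⟩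
  rcases eq_or_ne x 0 with rfl | hx
  · simp
  have P : t.HasPrimitiveVectorWith x (0 : ℂ) :=
    { ne_zero := hx
      lie_h := by rw [← lie_skew, hxh, neg_zero, zero_smul]
      lie_e := by rw [← lie_skew, hxe, neg_zero] }
  have hfx : ⁅f, x⁆ = 0 := by
    simpa using P.pow_toEnd_f_eq_zero_of_eq_nat (n := 0) (by simp)
  rw [← lie_skew, hfx, neg_zero]
end
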